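/- arXiv:2106.08583 — 3 statements merged into one kernel-verified Lean document; each statement's English description precedes it below -/
import Mathlib

section
/- Let (R, m) be a Noetherian local ring, and let M and N be finitely generated R-modules with N ≠ 0. If Tor_1^R(Tr M, M ⊗_R N) = 0, then M is a free R-module. -/
open CategoryTheory TensorProduct IsLocalRing

noncomputable section

/-- The `n`-th Ext group of two `R`-modules. -/
abbrev extGroup (R : Type) [CommRing R] (n : ℕ) (M N : Type) [AddCommGroup M] [Module R M]
    [AddCommGroup N] [Module R N] : Type :=
  ((Ext R (ModuleCat R) n).obj (Opposite.op (ModuleCat.of R M))).obj (ModuleCat.of R N)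

/-- The `n`-th Tor group of two `R`-modules. -/
abbrev torGroup (R : Type) [CommRing R] (n : ℕ) (M N : Type) [AddCommGroup M] [Module R M]
    [AddCommGroup N] [Module R N] : Type :=
  ((Tor (ModuleCat R) n).obj (ModuleCat.of R M)).obj (ModuleCat.of R N)

/-- The depth of a module over a local ring, as the infimum of the degrees in which
`Ext(k, N)` is nonzero. -/
def moduleDepth (R : Type) [CommRing R] [IsLocalRing R] (N : Type) [AddCommGroup N]
    [Module R N] : ℕ∞ :=
  sInf {n : ℕ∞ | ∃ k : ℕ, n = k ∧
    Nontrivial (extGroup R k (R ⧸ IsLocalRing.maximalIdeal R) N)}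

/-- A module is maximal Cohen–Macaulay if `depth M_p = dim R_p` for all `p` in the support. -/
def IsMCM (R : Type) [CommRing R] (M : Type) [AddCommGroup M] [Module R M] : Prop :=
  ∀ p : PrimeSpectrum R, Nontrivial (LocalizedModule p.asIdeal.primeCompl M) →
    (moduleDepth (Localization.AtPrime p.asIdeal)
        (LocalizedModule p.asIdeal.primeCompl M) : WithBot ℕ∞) =
      ringKrullDim (Localization.AtPrime p.asIdeal)

/-- A local ring is Cohen–Macaulay if its depth equals its Krull dimension. -/
def IsCMLocal (R : Type) [CommRing R] [IsLocalRing R] : Prop :=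
  (moduleDepth R R : WithBot ℕ∞) = ringKrullDim R

/-- Injective dimension at most `n`, defined recursively via cosyzygies. -/
def hasInjDimLE (R : Type) [CommRing R] : ℕ → ∀ (M : Type) [AddCommGroup M] [Module R M], Prop
  | 0, M, _, _ => Module.Injective R M
  | (n+1), M, _, _ => ∃ (I : Type) (_ : AddCommGroup I) (_ : Module R I) (f : M →ₗ[R] I),
      Module.Injective R I ∧ Function.Injective f ∧
        hasInjDimLE R n (I ⧸ LinearMap.range f)

/-- Projective dimension at most `n`, defined recursively via syzygies. -/
def hasPdLE (R : Type) [CommRing R] : ℕ → ∀ (M : Type) [AddCommGroup M] [Module R M], Prop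
  | 0, M, _, _ => Module.Projective R M
  | (n+1), M, _, _ => ∃ (P : Type) (_ : AddCommGroup P) (_ : Module R P) (f : P →ₗ[R] M),
      Module.Projective R P ∧ Function.Surjective f ∧ hasPdLE R n (LinearMap.ker f)

/-- `ω` is a canonical module of the Cohen–Macaulay local ring `R`: it is finitely generated,
maximal Cohen–Macaulay, of finite injective dimension, and of type one. -/
def IsCanonicalModule (R : Type) [CommRing R] [IsLocalRing R] (ω : Type) [AddCommGroup ω]
    [Module R ω] : Prop :=
  Module.Finite R ω ∧ IsMCM R ω ∧ (∃ n, hasInjDimLE R n ω) ∧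
    ∃ d : ℕ, ringKrullDim R = d ∧
      Nonempty (extGroup R d (R ⧸ IsLocalRing.maximalIdeal R) ω ≃ₗ[R]
        (R ⧸ IsLocalRing.maximalIdeal R))

/-- `T` is an Auslander transpose of `M`: the cokernel of the `R`-dual of a minimal
free presentation of `M`. -/
def IsAuslanderTranspose (R : Type) [CommRing R] [IsLocalRing R] (M T : Type)
    [AddCommGroup M] [Module R M] [AddCommGroup T] [Module R T] : Prop :=
  ∃ (m n : ℕ) (f : (Fin n → R) →ₗ[R] (Fin m → R)),
    LinearMap.range f ≤ (IsLocalRing.maximalIdeal R) • (⊤ : Submodule R (Fin m → R)) ∧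
    LinearMap.ker f ≤ (IsLocalRing.maximalIdeal R) • (⊤ : Submodule R (Fin n → R)) ∧
    Nonempty (((Fin m → R) ⧸ LinearMap.range f) ≃ₗ[R] M) ∧
    Nonempty ((Module.Dual R (Fin n → R) ⧸ LinearMap.range f.dualMap) ≃ₗ[R] T)

end

/-- If `Tor₁(T, X) = 0`, then the start `P₂ → P₁ → P₀ → X` of some projective resolution gives an
exact sequence `T ⊗ P₂ → T ⊗ P₁ → T ⊗ P₀`. -/
theorem exists_exact_lTensor_of_subsingleton_torGroup (R : Type) [CommRing R] (T X : Type)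
    [AddCommGroup T] [Module R T] [AddCommGroup X] [Module R X]
    (h : Subsingleton (torGroup R 1 T X)) :
    ∃ (P₀ P₁ P₂ : ModuleCat.{0} R) (π : P₀ →ₗ[R] X) (d₁ : P₁ →ₗ[R] P₀) (d₂ : P₂ →ₗ[R] P₁),
      Module.Projective R P₀ ∧ Function.Surjective π ∧ Function.Exact d₁ π ∧
      d₁ ∘ₗ d₂ = 0 ∧ Function.Exact (d₂.lTensor T) (d₁.lTensor T) := by
  let Q := projectiveResolution (ModuleCat.of R X)
  let F := (MonoidalCategory.tensoringLeft (ModuleCat.{0} R)).obj (ModuleCat.of R T)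
  have hF : (((F.mapHomologicalComplex _).obj Q.complex).sc' 2 1 0).Exact := by
    rw [← HomologicalComplex.exactAt_iff' _ 2 1 0 (by simp) (by simp),
      HomologicalComplex.exactAt_iff_isZero_homology]
    exact (@ModuleCat.isZero_of_subsingleton R _ _ h).of_iso (Q.isoLeftDerivedObj F 1).symm
  have hX : (ShortComplex.mk _ _ Q.complex_d_comp_π_f_zero).Exact :=
    ShortComplex.exact_of_g_is_cokernel _ Q.isColimitCokernelCofork
  refine ⟨Q.complex.X 0, Q.complex.X 1, Q.complex.X 2, (Q.π.f 0).hom, (Q.complex.d 1 0).hom,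
    (Q.complex.d 2 1).hom, ?_, ?_, ?_, ?_, ?_⟩
  · exact (IsProjective.iff_projective _).2 (Q.projective 0)
  · exact (ModuleCat.epi_iff_surjective (Q.π.f 0)).1 inferInstance
  · exact (ShortComplex.ShortExact.moduleCat_exact_iff_function_exact _).1 hX
  · exact congrArg ModuleCat.Hom.hom (Q.complex.d_comp_d 2 1 0)
  · exact (ShortComplex.ShortExact.moduleCat_exact_iff_function_exact _).1 hF

/-- If `f : F₁ → F₀` is a map of finite free modules with transposed cokernel `T`, and
`T ⊗ P₂ → T ⊗ P₁ → T ⊗ P₀` is exact, then every map `F₀ → P₀` whose restriction along `f` lands in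
the image of `P₁` can be corrected by a map `F₀ → P₁` to vanish on the image of `f`. -/
theorem exists_comp_eq_of_exact_lTensor {R F₀ F₁ T P₀ P₁ P₂ : Type*} [CommRing R]
    [AddCommGroup F₀] [Module R F₀] [Module.Free R F₀] [Module.Finite R F₀]
    [AddCommGroup F₁] [Module R F₁] [Module.Free R F₁] [Module.Finite R F₁]
    [AddCommGroup T] [Module R T] [AddCommGroup P₀] [Module R P₀]
    [AddCommGroup P₁] [Module R P₁] [AddCommGroup P₂] [Module R P₂]
    (f : F₁ →ₗ[R] F₀) (q : Module.Dual R F₁ →ₗ[R] T) (hq : Function.Surjective q)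
    (hfq : Function.Exact f.dualMap q) (d₁ : P₁ →ₗ[R] P₀) (d₂ : P₂ →ₗ[R] P₁)
    (hd : d₁ ∘ₗ d₂ = 0)
    (hT : Function.Exact (d₂.lTensor T) (d₁.lTensor T))
    (g : F₀ →ₗ[R] P₀) (u : F₁ →ₗ[R] P₁) (hu : d₁ ∘ₗ u = g ∘ₗ f) :
    ∃ w : F₀ →ₗ[R] P₁, d₁ ∘ₗ w ∘ₗ f = g ∘ₗ f := by
  obtain ⟨u', rfl⟩ := (dualTensorHom_bijective (R := R) (M := F₁) (N := P₁)).2 u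
  obtain ⟨g', rfl⟩ := (dualTensorHom_bijective (R := R) (M := F₀) (N := P₀)).2 g
  have key : d₁.lTensor _ u' = f.dualMap.rTensor P₀ g' := by
    apply (dualTensorHom_bijective (R := R) (M := F₁) (N := P₀)).1
    exact (LinearMap.congr_fun (dualTensorHom_comp_lTensor d₁) u').trans
      (hu.trans (LinearMap.congr_fun (dualTensorHom_comp_rTensor_dualMap f) g').symm)
  have hu0 : d₁.lTensor T (q.rTensor P₁ u') = 0 := by
    have := congrArg (q.rTensor P₀) key
    rw [← LinearMap.comp_apply, ← LinearMap.comp_apply, ← LinearMap.rTensor_comp,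
      hfq.linearMap_comp_eq_zero, LinearMap.rTensor_zero, LinearMap.zero_apply,
      LinearMap.rTensor_comp_lTensor] at this
    rwa [← LinearMap.comp_apply, LinearMap.lTensor_comp_rTensor]
  obtain ⟨t, ht⟩ := (hT _).1 hu0
  obtain ⟨v, rfl⟩ := LinearMap.rTensor_surjective P₂ hq t
  have hv : q.rTensor P₁ (u' - d₂.lTensor _ v) = 0 := by
    rw [map_sub, ← ht, sub_eq_zero, ← LinearMap.comp_apply, ← LinearMap.comp_apply,
      LinearMap.lTensor_comp_rTensor, LinearMap.rTensor_comp_lTensor]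
  obtain ⟨w, hw⟩ := (rTensor_exact P₁ hfq hq _).1 hv
  refine ⟨dualTensorHom R F₀ P₁ w, ?_⟩
  have hw' : dualTensorHom R F₀ P₁ w ∘ₗ f =
      dualTensorHom R F₁ P₁ u' - d₂ ∘ₗ dualTensorHom R F₁ P₂ v := by
    have h₁ := LinearMap.congr_fun (dualTensorHom_comp_rTensor_dualMap (P := P₁) f) w
    have h₂ := LinearMap.congr_fun (dualTensorHom_comp_lTensor (M := F₁) d₂) v
    simp only [LinearMap.comp_apply] at h₁ h₂
    rw [hw, map_sub, h₂] at h₁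
    exact h₁.symm
  rw [hw', LinearMap.comp_sub, hu, ← LinearMap.comp_assoc, hd, LinearMap.zero_comp, sub_zero]

/-- If `Tor₁(Tr M, X) = 0`, then every map `M → X` factors through a projective module that
does not depend on the map. -/
theorem exists_projective_lift_of_tor_transpose_vanishing (R : Type) [CommRing R] [IsLocalRing R]
    (M T X : Type) [AddCommGroup M] [Module R M] [AddCommGroup T] [Module R T]
    [AddCommGroup X] [Module R X] (hT : IsAuslanderTranspose R M T)
    (h : Subsingleton (torGroup R 1 T X)) :
    ∃ (P : ModuleCat.{0} R) (π : P →ₗ[R] X), Module.Projective R P ∧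
      ∀ φ : M →ₗ[R] X, ∃ ψ : M →ₗ[R] P, π ∘ₗ ψ = φ := by
  obtain ⟨P₀, P₁, P₂, π, d₁, d₂, hP, hπ, hd₁, hd, hd₂⟩ :=
    exists_exact_lTensor_of_subsingleton_torGroup R T X h
  refine ⟨P₀, π, hP, fun φ => ?_⟩
  obtain ⟨m, n, f, -, -, ⟨e⟩, ⟨e'⟩⟩ := hT
  let p : (Fin m → R) →ₗ[R] M := e.toLinearMap ∘ₗ (LinearMap.range f).mkQ
  have hp : Function.Surjective p := e.surjective.comp (Submodule.mkQ_surjective _)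
  have hkp : LinearMap.ker p = LinearMap.range f := by
    rw [LinearEquiv.ker_comp, Submodule.ker_mkQ]
  have hpf : p ∘ₗ f = 0 := LinearMap.range_le_ker_iff.1 hkp.ge
  let q : Module.Dual R (Fin n → R) →ₗ[R] T :=
    e'.toLinearMap ∘ₗ (LinearMap.range f.dualMap).mkQ
  have hq : Function.Surjective q := e'.surjective.comp (Submodule.mkQ_surjective _)
  have hfq : Function.Exact f.dualMap q := by
    rw [LinearMap.exact_iff, LinearEquiv.ker_comp, Submodule.ker_mkQ]
  obtain ⟨g, hg⟩ := Module.projective_lifting_property π (φ ∘ₗ p) hπ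
  have hgf : ∀ x, g (f x) ∈ LinearMap.range d₁ := fun x => by
    rw [← hd₁.linearMap_ker_eq, LinearMap.mem_ker, ← LinearMap.comp_apply, hg,
      LinearMap.comp_apply, ← LinearMap.comp_apply p, hpf, LinearMap.zero_apply, map_zero]
  obtain ⟨u, hu⟩ := Module.projective_lifting_property d₁.rangeRestrict
    ((g ∘ₗ f).codRestrict _ hgf) d₁.surjective_rangeRestrict
  obtain ⟨w, hw⟩ := exists_comp_eq_of_exact_lTensor f q hq hfq d₁ d₂ hd hd₂ g u
    (LinearMap.ext fun x => congrArg Subtype.val (LinearMap.congr_fun hu x))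
  have hker : LinearMap.ker p ≤ LinearMap.ker (g - d₁ ∘ₗ w) := by
    rw [hkp, LinearMap.range_le_ker_iff, LinearMap.sub_comp, LinearMap.comp_assoc, hw, sub_self]
  refine ⟨(LinearMap.ker p).liftQ _ hker ∘ₗ
    (p.quotKerEquivOfSurjective hp).symm.toLinearMap, ?_⟩
  rw [← LinearMap.cancel_right hp]
  refine LinearMap.ext fun x => ?_
  have hx : (p.quotKerEquivOfSurjective hp).symm (p x) = (LinearMap.ker p).mkQ x :=
    (LinearEquiv.symm_apply_eq _).2 rfl
  simp only [LinearMap.comp_apply, LinearEquiv.coe_coe, hx, Submodule.mkQ_apply,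
    Submodule.liftQ_apply, LinearMap.sub_apply, map_sub, hd₁.apply_apply_eq_zero, sub_zero]
  exact LinearMap.congr_fun hg x

/-- A nonzero finitely generated module over a local ring maps onto the residue field. -/
theorem exists_linearMap_residueField_eq_one (R N : Type*) [CommRing R] [IsLocalRing R]
    [AddCommGroup N] [Module R N] [Module.Finite R N] [Nontrivial N] :
    ∃ (φ : N →ₗ[R] ResidueField R) (y : N), φ y = 1 := by
  have : Nontrivial (ResidueField R ⊗[R] N) := by
    rw [← not_subsingleton_iff_nontrivial, IsLocalRing.subsingleton_tensorProduct,
      not_subsingleton_iff_nontrivial]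
    infer_instance
  obtain ⟨z, hz⟩ := exists_ne (0 : ResidueField R ⊗[R] N)
  obtain ⟨φ, hφ⟩ := Module.Projective.exists_dual_ne_zero (ResidueField R) hz
  obtain ⟨y, rfl⟩ := TensorProduct.mk_surjective R N (ResidueField R) residue_surjective z
  obtain ⟨r, hr⟩ := residue_surjective (φ (1 ⊗ₜ y))⁻¹
  refine ⟨φ.restrictScalars R ∘ₗ TensorProduct.mk R _ N 1, r • y, ?_⟩
  rw [map_smul, Algebra.smul_def]
  exact (congrArg (· * φ (1 ⊗ₜ y)) hr).trans (inv_mul_cancel₀ hφ)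

/-- If `N ≠ 0` and `Tor₁(Tr M, M ⊗ N) = 0`, then `M` is free. -/
theorem free_of_tor_transpose_vanishing (R : Type) [CommRing R] [IsNoetherianRing R]
    [IsLocalRing R] (M N T : Type) [AddCommGroup M] [Module R M] [Module.Finite R M]
    [AddCommGroup N] [Module R N] [Module.Finite R N] [Nontrivial N]
    [AddCommGroup T] [Module R T]
    (hT : IsAuslanderTranspose R M T)
    (h : Subsingleton (torGroup R 1 T (TensorProduct R M N))) :
    Module.Free R M := by
  obtain ⟨P, π, hP, hlift⟩ :=
    exists_projective_lift_of_tor_transpose_vanishing R M T (M ⊗[R] N) hT h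
  obtain ⟨φ, y, hφ⟩ := exists_linearMap_residueField_eq_one R N
  obtain ⟨ψ, hψ⟩ := hlift ((TensorProduct.mk R M N).flip y)
  let q : M ⊗[R] N →ₗ[R] ResidueField R ⊗[R] M :=
    (TensorProduct.comm R M (ResidueField R)).toLinearMap ∘ₗ φ.lTensor M
  have hmk : Function.Surjective (TensorProduct.mk R (ResidueField R) M 1) :=
    TensorProduct.mk_surjective _ _ _ residue_surjective
  obtain ⟨s, hs⟩ := Module.projective_lifting_property _ (q ∘ₗ π) hmk
  have hg : TensorProduct.mk R (ResidueField R) M 1 ∘ₗ (s ∘ₗ ψ) = TensorProduct.mk R _ M 1 := by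
    rw [← LinearMap.comp_assoc, hs, LinearMap.comp_assoc, hψ]
    ext x
    simp [q, hφ]
  have hsurj : Function.Surjective (s ∘ₗ ψ) := by
    rw [← LinearMap.range_eq_top, ← IsLocalRing.map_tensorProduct_mk_eq_top,
      ← LinearMap.range_comp, hg, LinearMap.range_eq_top]
    exact hmk
  let e := LinearEquiv.ofBijective (s ∘ₗ ψ)
    ⟨OrzechProperty.injective_of_surjective_endomorphism _ hsurj, hsurj⟩
  have : Module.Projective R M := by
    refine Module.Projective.of_split ψ (e.symm.toLinearMap ∘ₗ s) ?_
    ext x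
    exact e.symm_apply_apply x
  exact Module.free_of_flat_of_isLocalRing
end

section
/- Let (R, m) be a Noetherian local ring, and let M and N be finitely generated R-modules with depth_R N = 0. If Ext^1_R(Tr M, Hom_R(M, N)) = 0, then M is a free R-module. -/
open CategoryTheory TensorProduct IsLocalRing

section ExtGroup

open CategoryTheory

variable {R : Type} [CommRing R]

lemma extGroup_one_cocycle_eq_comp (T X : Type) [AddCommGroup T] [Module R T] [AddCommGroup X]
    [Module R X] (h : Subsingleton (extGroup R 1 T X))
    (P : ProjectiveResolution (ModuleCat.of R T)) (c : P.complex.X 1 ⟶ ModuleCat.of R X)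
    (hc : P.complex.d 2 1 ≫ c = 0) :
    ∃ b : P.complex.X 0 ⟶ ModuleCat.of R X, P.complex.d 1 0 ≫ b = c := by
  have hz : Limits.IsZero ((P.complex.linearYonedaObj R (ModuleCat.of R X)).homology 1) :=
    (ModuleCat.isZero_of_subsingleton _).of_iso (P.isoExt 1 (ModuleCat.of R X)).symm
  rw [← HomologicalComplex.exactAt_iff_isZero_homology,
    HomologicalComplex.exactAt_iff' _ 0 1 2 (by simp) (by simp),
    ShortComplex.moduleCat_exact_iff] at hz
  exact hz c hc

lemma extGroup_zero_subsingleton (T X : Type) [AddCommGroup T] [Module R T] [AddCommGroup X]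
    [Module R X] (h : ∀ g : T →ₗ[R] X, g = 0) : Subsingleton (extGroup R 0 T X) := by
  obtain ⟨P⟩ := HasProjectiveResolution.out (Z := ModuleCat.of R T)
  refine ModuleCat.subsingleton_of_isZero (Limits.IsZero.of_iso ?_ (P.isoExt 0 (ModuleCat.of R X)))
  rw [← HomologicalComplex.exactAt_iff_isZero_homology,
    HomologicalComplex.exactAt_iff' _ 0 0 1 (by simp) (by simp),
    ShortComplex.moduleCat_exact_iff]
  intro (c : P.complex.X 0 ⟶ ModuleCat.of R X) (hc : P.complex.d 1 0 ≫ c = 0)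
  refine ⟨0, ?_⟩
  have hd := P.isColimitCokernelCofork.fac (Limits.CokernelCofork.ofπ c hc)
    Limits.WalkingParallelPair.one
  have h0 : P.isColimitCokernelCofork.desc (Limits.CokernelCofork.ofπ c hc) = 0 :=
    ModuleCat.hom_ext (h _)
  rw [h0, Limits.comp_zero] at hd
  rw [map_zero]
  exact hd

/-- If `Ext¹(T, X) = 0`, maps into `X` extend along the kernel of a surjection
from a projective module to `T`. -/
lemma exists_extension_of_extGroup_one_subsingleton (T X F : Type) [AddCommGroup T] [Module R T]
    [AddCommGroup X] [Module R X] [AddCommGroup F] [Module R F] [Module.Projective R F]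
    (h : Subsingleton (extGroup R 1 T X)) (p : F →ₗ[R] T) (hp : Function.Surjective p)
    (α : LinearMap.ker p →ₗ[R] X) : ∃ γ : F →ₗ[R] X, ∀ z : LinearMap.ker p, γ z = α z := by
  obtain ⟨P⟩ := HasProjectiveResolution.out (Z := ModuleCat.of R T)
  let π : P.complex.X 0 →ₗ[R] T := (P.π.f 0).hom
  have hπ : Function.Surjective π := (ModuleCat.epi_iff_surjective (P.π.f 0)).1 inferInstance
  let d₁ : P.complex.X 1 →ₗ[R] P.complex.X 0 := (P.complex.d 1 0).hom
  let d₂ : P.complex.X 2 →ₗ[R] P.complex.X 1 := (P.complex.d 2 1).hom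
  have hd₁ (x) : π (d₁ x) = 0 :=
    LinearMap.congr_fun (congrArg ModuleCat.Hom.hom P.complex_d_comp_π_f_zero) x
  have hd₂ (x) : d₁ (d₂ x) = 0 :=
    LinearMap.congr_fun (congrArg ModuleCat.Hom.hom (P.complex.d_comp_d 2 1 0)) x
  have hex (y) (hy : π y = 0) : ∃ x, d₁ x = y :=
    (ShortComplex.moduleCat_exact_iff _).1 P.exact₀ y hy
  have : Module.Projective R (P.complex.X 0) :=
    (P.complex.X 0).projective_of_module_projective
  obtain ⟨u, hu⟩ := Module.projective_lifting_property p π hp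
  obtain ⟨v, hv⟩ := Module.projective_lifting_property π p hπ
  replace hu (x) : p (u x) = π x := LinearMap.congr_fun hu x
  replace hv (x) : π (v x) = p x := LinearMap.congr_fun hv x
  let u₁ : P.complex.X 1 →ₗ[R] LinearMap.ker p :=
    (u ∘ₗ d₁).codRestrict _ fun x ↦ by simp [hu, hd₁]
  let s : F →ₗ[R] LinearMap.ker p :=
    (u ∘ₗ v - LinearMap.id).codRestrict _ fun x ↦ by simp [hu, hv]
  obtain ⟨b, hb⟩ := extGroup_one_cocycle_eq_comp T X h P (ModuleCat.ofHom (α ∘ₗ u₁)) (by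
    ext x
    change α (u₁ (d₂ x)) = 0
    have : u₁ (d₂ x) = 0 := Subtype.ext (by simp [u₁, hd₂])
    rw [this, map_zero])
  have hb' (x) : b.hom (d₁ x) = α (u₁ x) := LinearMap.congr_fun (congrArg ModuleCat.Hom.hom hb) x
  refine ⟨b.hom ∘ₗ v - α ∘ₗ s, fun z ↦ ?_⟩
  obtain ⟨x, hx⟩ := hex (v z) (by rw [hv]; exact z.2)
  have hsz : u₁ x - s z = z := Subtype.ext (by simp [u₁, s, hx])
  change b.hom (v z) - α (s z) = α z
  rw [← hx, hb', ← map_sub, hsz]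

lemma exists_comp_eq_of_ker_le {A B X : Type} [AddCommGroup A] [Module R A] [AddCommGroup B]
    [Module R B] [AddCommGroup X] [Module R X] (q : A →ₗ[R] B) (hq : Function.Surjective q)
    (l : A →ₗ[R] X) (hl : LinearMap.ker q ≤ LinearMap.ker l) :
    ∃ k : B →ₗ[R] X, ∀ a, k (q a) = l a := by
  refine ⟨(LinearMap.ker q).liftQ l hl ∘ₗ (q.quotKerEquivOfSurjective hq).symm.toLinearMap,
    fun a ↦ ?_⟩
  have : (q.quotKerEquivOfSurjective hq).symm (q a) = (LinearMap.ker q).mkQ a := by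
    rw [LinearEquiv.symm_apply_eq]
    rfl
  simp [this]

lemma exists_comp_eq_of_extGroup_one_subsingleton {T X F G : Type} [AddCommGroup T] [Module R T]
    [AddCommGroup X] [Module R X] [AddCommGroup F] [Module R F] [Module.Projective R F]
    [AddCommGroup G] [Module R G] (f : G →ₗ[R] F) (e : (F ⧸ LinearMap.range f) ≃ₗ[R] T)
    (h : Subsingleton (extGroup R 1 T X)) (l : G →ₗ[R] X)
    (hl : LinearMap.ker f ≤ LinearMap.ker l) : ∃ γ : F →ₗ[R] X, ∀ y, γ (f y) = l y := by
  let p : F →ₗ[R] T := e.toLinearMap ∘ₗ (LinearMap.range f).mkQ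
  have hp : Function.Surjective p := e.surjective.comp (Submodule.mkQ_surjective _)
  have hpk : LinearMap.ker p = LinearMap.range f := by simp [p, LinearMap.ker_comp]
  let q : G →ₗ[R] LinearMap.ker p := f.codRestrict _ fun y ↦ by rw [hpk]; exact ⟨y, rfl⟩
  have hq : Function.Surjective q := by
    rintro ⟨z, hz⟩
    obtain ⟨y, rfl⟩ := hpk ▸ hz
    exact ⟨y, rfl⟩
  obtain ⟨α, hα⟩ := exists_comp_eq_of_ker_le q hq l (by simpa [q, LinearMap.ker_codRestrict])
  obtain ⟨γ, hγ⟩ := exists_extension_of_extGroup_one_subsingleton T X F h p hp α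
  exact ⟨γ, fun y ↦ (hγ (q y)).trans (hα y)⟩

/-- An identity `γ(ψ ∘ f) = ψ(v) • g` for all functionals `ψ` forces `g` to kill the class of `v`
in the cokernel of `f`. -/
lemma apply_eq_zero_of_comp_eq_smul {M N : Type} [AddCommGroup M]
    [Module R M] [AddCommGroup N] [Module R N] {m n : ℕ}
    (f : (Fin n → R) →ₗ[R] (Fin m → R)) (π : (Fin m → R) →ₗ[R] M) (hπf : ∀ y, π (f y) = 0)
    (γ : Module.Dual R (Fin n → R) →ₗ[R] (M →ₗ[R] N)) (g : M →ₗ[R] N) (v : Fin m → R)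
    (hγ : ∀ ψ : Module.Dual R (Fin m → R), γ (ψ ∘ₗ f) = ψ v • g) : g (π v) = 0 := by
  have hexp (ψ : Module.Dual R (Fin n → R)) :
      ψ = ∑ j, ψ (Pi.single j 1) • (LinearMap.proj j : (Fin n → R) →ₗ[R] R) := by
    refine LinearMap.pi_ext' fun j ↦ LinearMap.ext_ring ?_
    simp [Pi.single_apply]
  have hsum (w : Fin m → R) : ∑ k, w k • π (Pi.single k 1) = π w := by
    simp only [← map_smul, ← map_sum]
    congr 1
    ext k
    simp [Finset.sum_apply, Pi.single_apply]
  have hcoord (k : Fin m) :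
      v k • g = ∑ j, f (Pi.single j 1) k • γ (LinearMap.proj j) := by
    rw [← LinearMap.proj_apply (R := R) (φ := fun _ ↦ R) k v, ← hγ, hexp (LinearMap.proj k ∘ₗ f),
      map_sum]
    simp only [map_smul, LinearMap.comp_apply, LinearMap.proj_apply]
  calc g (π v) = ∑ k, (v k • g) (π (Pi.single k 1)) := by
        simp only [← hsum v, map_sum, map_smul, LinearMap.smul_apply]
    _ = ∑ j, ∑ k, f (Pi.single j 1) k • γ (LinearMap.proj j) (π (Pi.single k 1)) := by
        simp only [hcoord, LinearMap.sum_apply, LinearMap.smul_apply]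
        exact Finset.sum_comm
    _ = ∑ j, γ (LinearMap.proj j) (π (f (Pi.single j 1))) := by
        refine Finset.sum_congr rfl fun j _ ↦ ?_
        rw [← hsum (f _)]
        simp only [map_sum, map_smul]
    _ = 0 := by simp only [hπf, map_zero, Finset.sum_const_zero]

/-- Vanishing of `Ext¹(Tr M, Hom(M, N))` makes the natural map
`M ⊗ Hom(M, N) → Hom(M*, Hom(M, N))` injective; applied to `x ⊗ g`. -/
lemma apply_eq_zero_of_extGroup_transpose_subsingleton {M N T : Type} [AddCommGroup M]
    [Module R M] [AddCommGroup N] [Module R N] [AddCommGroup T] [Module R T] {m n : ℕ}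
    (f : (Fin n → R) →ₗ[R] (Fin m → R)) (π : (Fin m → R) →ₗ[R] M)
    (hπ : Function.Surjective π) (hker : LinearMap.ker π = LinearMap.range f)
    (e : (Module.Dual R (Fin n → R) ⧸ LinearMap.range f.dualMap) ≃ₗ[R] T)
    (h : Subsingleton (extGroup R 1 T (M →ₗ[R] N))) (g : M →ₗ[R] N) (x : M)
    (hgx : ∀ φ : Module.Dual R M, φ x • g = 0) : g x = 0 := by
  obtain ⟨v, rfl⟩ := hπ x
  have hev : LinearMap.ker f.dualMap ≤
      LinearMap.ker ((LinearMap.toSpanSingleton R _ g) ∘ₗ Module.Dual.eval R _ v) := by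
    intro ψ (hψ : ψ ∘ₗ f = 0)
    have hle : LinearMap.ker π ≤ LinearMap.ker ψ := by
      rw [hker]
      rintro _ ⟨y, rfl⟩
      exact LinearMap.congr_fun hψ y
    obtain ⟨φ, hφ⟩ := exists_comp_eq_of_ker_le π hπ ψ hle
    change ψ v • g = 0
    rw [← hφ, hgx]
  obtain ⟨γ, hγ⟩ := exists_comp_eq_of_extGroup_one_subsingleton f.dualMap e h _ hev
  have hπf (y) : π (f y) = 0 := by
    rw [← LinearMap.mem_ker, hker]
    exact ⟨y, rfl⟩
  exact apply_eq_zero_of_comp_eq_smul f π hπf γ g v hγ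

end ExtGroup

section Local

open IsLocalRing TensorProduct

variable {R : Type} [CommRing R] [IsLocalRing R]

lemma exists_ne_zero_of_moduleDepth_eq_zero {N : Type} [AddCommGroup N] [Module R N]
    (h : moduleDepth R N = 0) : ∃ i : (R ⧸ maximalIdeal R) →ₗ[R] N, i ≠ 0 := by
  by_contra! hN
  have hne : {n : ℕ∞ | ∃ k : ℕ, n = k ∧
      Nontrivial (extGroup R k (R ⧸ maximalIdeal R) N)}.Nonempty := by
    rw [Set.nonempty_iff_ne_empty]
    intro he
    rw [moduleDepth, he, sInf_empty] at h
    exact ENat.top_ne_zero h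
  obtain ⟨k, hk, hnt⟩ := csInf_mem hne
  rw [← moduleDepth, h] at hk
  obtain rfl : k = 0 := by exact_mod_cast hk.symm
  exact not_subsingleton_iff_nontrivial.2 hnt (extGroup_zero_subsingleton _ _ hN)

/-- A minimal generator of `M` is not killed by some map from `M` into the socle of `N`. -/
lemma exists_socle_hom_apply_ne_zero {M N : Type} [AddCommGroup M] [Module R M]
    [AddCommGroup N] [Module R N] (i : (R ⧸ maximalIdeal R) →ₗ[R] N) (hi : i ≠ 0) (x : M)
    (hx : x ∉ maximalIdeal R • (⊤ : Submodule R M)) :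
    ∃ g : M →ₗ[R] N, (∀ a ∈ maximalIdeal R, a • g = 0) ∧ g x ≠ 0 := by
  let _ : Field (R ⧸ maximalIdeal R) := Ideal.Quotient.field _
  let S : Submodule R M := maximalIdeal R • ⊤
  have hx' : S.mkQ x ≠ 0 := by simpa [S] using hx
  obtain ⟨l, hl⟩ : ∃ l : Module.Dual (R ⧸ maximalIdeal R) (M ⧸ S), l (S.mkQ x) ≠ 0 := by
    by_contra! hc
    exact hx' ((Module.forall_dual_apply_eq_zero_iff (R ⧸ maximalIdeal R) (S.mkQ x)).1 hc)
  refine ⟨i ∘ₗ l.restrictScalars R ∘ₗ S.mkQ, fun a ha ↦ ?_, fun h0 ↦ hi ?_⟩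
  · ext y
    change a • i (l (S.mkQ y)) = 0
    obtain ⟨r, hr⟩ := Ideal.Quotient.mk_surjective (l (S.mkQ y))
    rw [← map_smul, ← hr, Algebra.smul_def, Ideal.Quotient.algebraMap_eq,
      Ideal.Quotient.eq_zero_iff_mem.2 ha, zero_mul, map_zero]
  · replace h0 : i (l (S.mkQ x)) = 0 := h0
    refine LinearMap.ext fun q ↦ ?_
    obtain ⟨r, hr⟩ := Ideal.Quotient.mk_surjective (q * (l (S.mkQ x))⁻¹)
    have hq : q = r • l (S.mkQ x) := by
      rw [Algebra.smul_def, Ideal.Quotient.algebraMap_eq, hr, inv_mul_cancel_right₀ hl]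
    rw [hq, map_smul, h0, smul_zero, LinearMap.zero_apply]

/-- If every minimal generator of `M` has unit image under some functional, then `M` is free. -/
lemma free_of_forall_dual_mem_maximalIdeal [IsNoetherianRing R] {M : Type} [AddCommGroup M]
    [Module R M] [Module.Finite R M] {m : ℕ} (π : (Fin m → R) →ₗ[R] M)
    (hπ : Function.Surjective π)
    (hker : LinearMap.ker π ≤ maximalIdeal R • (⊤ : Submodule R (Fin m → R)))
    (h : ∀ x : M, (∀ φ : Module.Dual R M, φ x ∈ maximalIdeal R) →
      x ∈ maximalIdeal R • (⊤ : Submodule R M)) : Module.Free R M := by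
  obtain ⟨n, s, hs⟩ := Module.Finite.exists_fin (R := R) (M := Module.Dual R M)
  let l : (Fin m → R) →ₗ[R] (Fin n → R) := LinearMap.pi s ∘ₗ π
  have hl : Function.Injective (l.lTensor (ResidueField R)) := by
    rw [injective_iff_map_eq_zero]
    intro t ht
    obtain ⟨v, rfl⟩ := TensorProduct.mk_surjective R (Fin m → R) (ResidueField R)
      residue_surjective t
    have hs' (j) : s j (π v) ∈ maximalIdeal R := by
      have := congrArg (TensorProduct.rid R (ResidueField R) ∘
        (LinearMap.proj j : (Fin n → R) →ₗ[R] R).lTensor (ResidueField R)) ht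
      simpa [l, Algebra.smul_def, ResidueField.algebraMap_eq] using this
    have hφ (φ : Module.Dual R M) : φ (π v) ∈ maximalIdeal R := by
      have hmem : φ ∈ Submodule.span R (Set.range s) := hs ▸ Submodule.mem_top
      induction hmem using Submodule.span_induction with
      | mem φ hφ => obtain ⟨j, rfl⟩ := hφ; exact hs' j
      | zero => simp
      | add φ ψ _ _ h₁ h₂ => exact add_mem h₁ h₂
      | smul a φ _ h₁ => exact Ideal.mul_mem_left _ a h₁
    have hv : v ∈ maximalIdeal R • (⊤ : Submodule R (Fin m → R)) := by
      have hx := h _ hφ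
      rw [← LinearMap.range_eq_top.2 hπ, ← Submodule.map_top, ← Submodule.map_smul''] at hx
      obtain ⟨w, hw, hwv⟩ := hx
      rw [← sub_add_cancel v w]
      exact add_mem (hker (by simp [hwv])) hw
    clear ht hs' hφ
    induction hv using Submodule.smul_induction_on' with
    | smul a ha w _ =>
      rw [TensorProduct.mk_apply, ← TensorProduct.smul_tmul, Algebra.smul_def,
        ResidueField.algebraMap_eq, (residue_eq_zero_iff a).2 ha, zero_mul, zero_tmul]
    | add _ _ _ _ h₁ h₂ => rw [map_add, h₁, h₂, add_zero]
  obtain ⟨l', hl'⟩ := (split_injective_iff_lTensor_residueField_injective l).2 hl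
  have hinj : Function.Injective π := by
    have : Function.Injective (LinearMap.pi s ∘ π) :=
      Function.LeftInverse.injective (LinearMap.congr_fun hl')
    exact this.of_comp
  exact Module.Free.of_equiv (LinearEquiv.ofBijective π ⟨hinj, hπ⟩)

end Local

/-- If `depth N = 0` and `Ext¹(Tr M, Hom(M, N)) = 0`, then `M` is free. -/
theorem free_of_ext_transpose_vanishing (R : Type) [CommRing R] [IsNoetherianRing R]
    [IsLocalRing R] (M N T : Type) [AddCommGroup M] [Module R M] [Module.Finite R M]
    [AddCommGroup N] [Module R N] [Module.Finite R N]
    [AddCommGroup T] [Module R T]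
    (hdepth : moduleDepth R N = 0)
    (hT : IsAuslanderTranspose R M T)
    (h : Subsingleton (extGroup R 1 T (M →ₗ[R] N))) :
    Module.Free R M := by
  obtain ⟨i, hi⟩ := exists_ne_zero_of_moduleDepth_eq_zero hdepth
  obtain ⟨m, n, f, hf, -, ⟨e⟩, ⟨e'⟩⟩ := hT
  let π : (Fin m → R) →ₗ[R] M := e.toLinearMap ∘ₗ (LinearMap.range f).mkQ
  have hπ : Function.Surjective π := e.surjective.comp (Submodule.mkQ_surjective _)
  have hker : LinearMap.ker π = LinearMap.range f := by simp [π, LinearMap.ker_comp]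
  refine free_of_forall_dual_mem_maximalIdeal π hπ (hker.trans_le hf) fun x hx ↦ ?_
  by_contra hxm
  obtain ⟨g, hg, hgx⟩ := exists_socle_hom_apply_ne_zero i hi x hxm
  exact hgx (apply_eq_zero_of_extGroup_transpose_subsingleton f π hπ hker e' h g x
    fun φ ↦ hg _ (hx φ))
end

section
/- Let R be a Cohen–Macaulay local ring admitting a canonical module ω. Let M be a finitely generated R-module and N a maximal Cohen–Macaulay R-module. Then M ⊗_R N is maximal Cohen–Macaulay if and only if Tr M ⊗_R Hom_R(N, ω) is maximal Cohen–Macaulay. -/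
open CategoryTheory TensorProduct IsLocalRing

/-- `Ext^i(X, Y)` vanishes. -/
abbrev ExtZero (R : Type) [CommRing R] (X Y : Type) [AddCommGroup X] [Module R X]
    [AddCommGroup Y] [Module R Y] (i : ℕ) : Prop :=
  Subsingleton (Abelian.Ext.{0} (ModuleCat.of R X) (ModuleCat.of R Y) i)

section ExtZero

variable {R : Type} [CommRing R]
variable {X A B C : Type} [AddCommGroup X] [Module R X] [AddCommGroup A] [Module R A]
  [AddCommGroup B] [Module R B] [AddCommGroup C] [Module R C]

theorem subsingleton_extGroup_iff (i : ℕ) : Subsingleton (extGroup R i X A) ↔ ExtZero R X A i := by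
  let P := projectiveResolution (ModuleCat.of R X)
  have e := P.isoExt (R := R) i (ModuleCat.of R A)
  rw [extGroup, ← ModuleCat.isZero_iff_subsingleton, e.isZero_iff,
    ← HomologicalComplex.exactAt_iff_isZero_homology]
  have key (j k : ℕ) (hj : (ComplexShape.up ℕ).prev i = j) (hk : i + 1 = k) :
      (P.complex.linearYonedaObj R (ModuleCat.of R A)).ExactAt i ↔
      ∀ f : P.complex.X i ⟶ ModuleCat.of R A, P.complex.d k i ≫ f = 0 →
        ∃ g : P.complex.X j ⟶ ModuleCat.of R A, P.complex.d i j ≫ g = f := by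
    rw [HomologicalComplex.exactAt_iff' _ j i k hj ((ComplexShape.up ℕ).next_eq' hk),
      ShortComplex.moduleCat_exact_iff]
    rfl
  cases i with
  | zero =>
    rw [key 0 1 (by simp) rfl]
    constructor
    · intro h
      rw [ExtZero, Abelian.Ext.addEquiv₀.toEquiv.subsingleton_congr]
      refine subsingleton_of_forall_eq 0 fun f => ?_
      have h0 : P.complex.d 0 0 = 0 := P.complex.shape _ _ (by simp)
      let π : P.complex.X 0 ⟶ ModuleCat.of R X := P.π.f 0
      have hπ : P.complex.d 1 0 ≫ π = 0 := P.complex_d_comp_π_f_zero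
      have : Epi π := inferInstanceAs (Epi (P.π.f 0))
      obtain ⟨g, hg⟩ := h (π ≫ f) (by rw [← Category.assoc, hπ, Limits.zero_comp])
      rw [h0, Limits.zero_comp] at hg
      rw [← cancel_epi π, ← hg, Limits.comp_zero]
    · intro h f hf
      rw [ExtZero, Abelian.Ext.addEquiv₀.toEquiv.subsingleton_congr] at h
      refine ⟨0, ?_⟩
      have h1 := (Limits.CokernelCofork.IsColimit.desc' P.isColimitCokernelCofork f hf)
      have h2 := h1.2
      rw [h.elim (α := ModuleCat.of R X ⟶ ModuleCat.of R A) h1.1 0] at h2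
      rw [← h2]
      simp
  | succ n =>
    rw [key n (n + 2) (by simp) rfl]
    constructor
    · intro h
      refine subsingleton_of_forall_eq 0 fun α => ?_
      obtain ⟨f, hf, rfl⟩ := P.extMk_surjective α (n + 2) rfl
      rw [P.extMk_eq_zero_iff f _ rfl hf n rfl]
      exact h f hf
    · intro h f hf
      rw [← P.extMk_eq_zero_iff f (n + 2) rfl hf n rfl]
      exact h.elim _ _

/-- The short exact sequence in `ModuleCat R` given by linear maps. -/
theorem shortExact_ofLinearMap {f : A →ₗ[R] B} {g : B →ₗ[R] C} (hf : Function.Injective f)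
    (hg : Function.Surjective g) (h : Function.Exact f g) :
    (ModuleCat.shortComplexOfCompEqZero f g h.linearMap_comp_eq_zero).ShortExact where
  exact := ModuleCat.shortComplex_exact _ h
  mono_f := (ModuleCat.mono_iff_injective _).2 hf
  epi_g := (ModuleCat.epi_iff_surjective _).2 hg

namespace ExtZero

theorem of_retract {i : ℕ} (f : A →ₗ[R] B) (g : B →ₗ[R] A) (h : g ∘ₗ f = LinearMap.id)
    (hB : ExtZero R X B i) : ExtZero R X A i := by
  refine subsingleton_of_forall_eq 0 fun α => ?_
  have h1 : α = (α.comp (Abelian.Ext.mk₀ (ModuleCat.ofHom f)) (add_zero i)).comp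
      (Abelian.Ext.mk₀ (ModuleCat.ofHom g)) (add_zero i) := by
    rw [Abelian.Ext.comp_assoc_of_third_deg_zero, Abelian.Ext.mk₀_comp_mk₀, ← ModuleCat.ofHom_comp,
      h, ModuleCat.ofHom_id, Abelian.Ext.comp_mk₀_id]
  rw [h1, Subsingleton.elim (α.comp (Abelian.Ext.mk₀ (ModuleCat.ofHom f)) (add_zero i)) 0,
    Abelian.Ext.zero_comp]

section

variable {f : A →ₗ[R] B} {g : B →ₗ[R] C} (hf : Function.Injective f)
    (hg : Function.Surjective g) (h : Function.Exact f g)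
include hf hg h

theorem covariant_left {i : ℕ} (hC : ExtZero R X C i) (hB : ExtZero R X B (i + 1)) :
    ExtZero R X A (i + 1) := by
  refine subsingleton_of_forall_eq 0 fun α => ?_
  obtain ⟨β, rfl⟩ := Abelian.Ext.covariant_sequence_exact₁ _ (shortExact_ofLinearMap hf hg h) α
    (hB.elim _ _) rfl
  rw [hC.elim β 0, Abelian.Ext.zero_comp]

theorem covariant_mid {i : ℕ} (hA : ExtZero R X A i) (hC : ExtZero R X C i) :
    ExtZero R X B i := by
  refine subsingleton_of_forall_eq 0 fun α => ?_
  obtain ⟨β, rfl⟩ := Abelian.Ext.covariant_sequence_exact₂ _ (shortExact_ofLinearMap hf hg h) α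
    (hC.elim _ _)
  rw [hA.elim β 0, Abelian.Ext.zero_comp]

theorem covariant_right {i : ℕ} (hB : ExtZero R X B i) (hA : ExtZero R X A (i + 1)) :
    ExtZero R X C i := by
  refine subsingleton_of_forall_eq 0 fun α => ?_
  obtain ⟨β, rfl⟩ := Abelian.Ext.covariant_sequence_exact₃ _ (shortExact_ofLinearMap hf hg h) α
    rfl (hA.elim _ _)
  rw [hB.elim β 0, Abelian.Ext.zero_comp]

theorem covariant_left_zero (hB : ExtZero R X B 0) : ExtZero R X A 0 := by
  have := (shortExact_ofLinearMap hf hg h).mono_f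
  exact (Abelian.Ext.postcomp_mk₀_injective_of_mono (ModuleCat.of R X)
    (ModuleCat.shortComplexOfCompEqZero f g h.linearMap_comp_eq_zero).f).subsingleton

theorem contravariant_left {i : ℕ} (hB : ExtZero R B X i) (hC : ExtZero R C X (i + 1)) :
    ExtZero R A X i := by
  refine subsingleton_of_forall_eq 0 fun α => ?_
  obtain ⟨β, rfl⟩ := Abelian.Ext.contravariant_sequence_exact₁ (shortExact_ofLinearMap hf hg h) _ α
    (add_comm 1 i) (hC.elim _ _)
  rw [hB.elim β 0, Abelian.Ext.comp_zero]

theorem contravariant_mid {i : ℕ} (hA : ExtZero R A X i) (hC : ExtZero R C X i) :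
    ExtZero R B X i := by
  refine subsingleton_of_forall_eq 0 fun α => ?_
  obtain ⟨β, rfl⟩ := Abelian.Ext.contravariant_sequence_exact₂ (shortExact_ofLinearMap hf hg h) _ α
    (hA.elim _ _)
  rw [hC.elim β 0, Abelian.Ext.comp_zero]

theorem contravariant_right {i : ℕ} (hA : ExtZero R A X i) (hB : ExtZero R B X (i + 1)) :
    ExtZero R C X (i + 1) := by
  refine subsingleton_of_forall_eq 0 fun α => ?_
  obtain ⟨β, rfl⟩ := Abelian.Ext.contravariant_sequence_exact₃ (shortExact_ofLinearMap hf hg h) _ α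
    (hB.elim _ _) (add_comm 1 i)
  rw [hA.elim β 0, Abelian.Ext.comp_zero]

/-- If `Ext¹(C, X) = 0`, maps into `X` extend along `A → B`. -/
theorem exists_extension (hC : ExtZero R C X 1) (φ : A →ₗ[R] X) : ∃ ψ : B →ₗ[R] X, ψ ∘ₗ f = φ := by
  obtain ⟨β, hβ⟩ := Abelian.Ext.contravariant_sequence_exact₁ (shortExact_ofLinearMap hf hg h) _
    (Abelian.Ext.mk₀ (ModuleCat.ofHom φ)) (add_comm 1 0) (hC.elim _ _)
  obtain ⟨ψ, rfl⟩ := Abelian.Ext.addEquiv₀.symm.surjective β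
  refine ⟨ψ.hom, ?_⟩
  rw [Abelian.Ext.addEquiv₀_symm_apply, Abelian.Ext.mk₀_comp_mk₀] at hβ
  have := congrArg ModuleCat.Hom.hom (Abelian.Ext.addEquiv₀.symm.injective hβ)
  exact this

end

theorem of_equiv_right {i : ℕ} (e : A ≃ₗ[R] B) (hB : ExtZero R X B i) : ExtZero R X A i :=
  of_retract e.toLinearMap e.symm.toLinearMap (by simp) hB

theorem of_projective [Module.Projective R A] (i : ℕ) : ExtZero R A X (i + 1) := by
  have : Projective (ModuleCat.of R A) := (IsProjective.iff_projective A).1 inferInstance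
  exact Abelian.Ext.subsingleton_of_projective _ _ _

theorem of_injective (hX : Module.Injective R X) (i : ℕ) : ExtZero R A X (i + 1) := by
  have : Injective (ModuleCat.of R X) := Module.injective_object_of_injective_module R X
  exact subsingleton_of_forall_eq 0 fun α => Abelian.Ext.eq_zero_of_injective α

theorem zero_iff : ExtZero R A B 0 ↔ Subsingleton (A →ₗ[R] B) :=
  (Abelian.Ext.addEquiv₀.trans ModuleCat.homAddEquiv).toEquiv.subsingleton_congr

theorem of_subsingleton_right [Subsingleton A] (i : ℕ) : ExtZero R X A i := by
  refine subsingleton_of_forall_eq 0 fun α => ?_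
  rw [← α.comp_mk₀_id, (ModuleCat.isZero_of_subsingleton (ModuleCat.of R A)).eq_of_src (𝟙 _) 0,
    Abelian.Ext.mk₀_zero, Abelian.Ext.comp_zero]

end ExtZero

end ExtZero

section Local

variable {R : Type} [CommRing R]
variable {X A B C : Type} [AddCommGroup X] [Module R X] [AddCommGroup A] [Module R A]
  [AddCommGroup B] [Module R B] [AddCommGroup C] [Module R C]

namespace ExtZero

theorem of_retract_left {i : ℕ} (f : A →ₗ[R] B) (g : B →ₗ[R] A) (h : g ∘ₗ f = LinearMap.id)
    (hB : ExtZero R B X i) : ExtZero R A X i := by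
  refine subsingleton_of_forall_eq 0 fun α => ?_
  have h1 : α = (Abelian.Ext.mk₀ (ModuleCat.ofHom f)).comp
      ((Abelian.Ext.mk₀ (ModuleCat.ofHom g)).comp α (zero_add i)) (zero_add i) := by
    rw [Abelian.Ext.mk₀_comp_mk₀_assoc, ← ModuleCat.ofHom_comp,
      h, ModuleCat.ofHom_id, Abelian.Ext.mk₀_id_comp]
  rw [h1, Subsingleton.elim ((Abelian.Ext.mk₀ (ModuleCat.ofHom g)).comp α (zero_add i)) 0,
    Abelian.Ext.comp_zero]

theorem of_equiv_left {i : ℕ} (e : A ≃ₗ[R] B) (hB : ExtZero R B X i) : ExtZero R A X i :=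
  of_retract_left e.toLinearMap e.symm.toLinearMap (by simp) hB

theorem of_subsingleton_left [Subsingleton A] (i : ℕ) : ExtZero R A X i := by
  refine subsingleton_of_forall_eq 0 fun α => ?_
  rw [← α.mk₀_id_comp, (ModuleCat.isZero_of_subsingleton (ModuleCat.of R A)).eq_of_src (𝟙 _) 0,
    Abelian.Ext.mk₀_zero, Abelian.Ext.zero_comp]

theorem comp_mk₀_smul {i : ℕ} (α : Abelian.Ext.{0} (ModuleCat.of R X) (ModuleCat.of R A) i)
    (x : R) : α.comp (Abelian.Ext.mk₀ (ModuleCat.ofHom (LinearMap.lsmul R A x))) (add_zero i) =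
      x • α := by
  have : ModuleCat.ofHom (LinearMap.lsmul R A x) = x • 𝟙 (ModuleCat.of R A) := rfl
  rw [this, Abelian.Ext.mk₀_smul, Abelian.Ext.comp_smul, Abelian.Ext.comp_mk₀_id]

theorem mk₀_smul_comp {i : ℕ} (α : Abelian.Ext.{0} (ModuleCat.of R A) (ModuleCat.of R X) i)
    (x : R) : (Abelian.Ext.mk₀ (ModuleCat.ofHom (LinearMap.lsmul R A x))).comp α (zero_add i) =
      x • α := by
  have : ModuleCat.ofHom (LinearMap.lsmul R A x) = x • 𝟙 (ModuleCat.of R A) := rfl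
  rw [this, Abelian.Ext.mk₀_smul, Abelian.Ext.smul_comp, Abelian.Ext.mk₀_id_comp]

/-- If `x` is in the maximal ideal and regular on `A`, vanishing of `Ext^{i+1}(A/xA, X)` forces
vanishing of `Ext^i(A, X)`, by Nakayama's lemma. -/
theorem of_quotSMulTop_left [IsNoetherianRing R] [IsLocalRing R] [Module.Finite R A]
    [Module.Finite R X] {x : R} (hx : x ∈ maximalIdeal R) (hreg : IsSMulRegular A x) {i : ℕ}
    (h : ExtZero R (QuotSMulTop x A) X (i + 1)) : ExtZero R A X i := by
  have key (α : Abelian.Ext.{0} (ModuleCat.of R A) (ModuleCat.of R X) i) : ∃ β, α = x • β := by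
    obtain ⟨β, rfl⟩ := Abelian.Ext.contravariant_sequence_exact₁
      (shortExact_ofLinearMap (f := LinearMap.lsmul R A x) hreg (Submodule.mkQ_surjective _)
        (LinearMap.exact_lsmul_mkQ_smul_top A x)) _ α (add_comm 1 i) (h.elim _ _)
    exact ⟨β, mk₀_smul_comp β x⟩
  have h1 : (⊤ : Submodule R (Abelian.Ext.{0} (ModuleCat.of R A) (ModuleCat.of R X) i)) = ⊥ := by
    apply Submodule.eq_bot_of_le_smul_of_le_jacobson_bot (maximalIdeal R) _ (Module.Finite.fg_top)
    · intro α _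
      obtain ⟨β, rfl⟩ := key α
      exact Submodule.smul_mem_smul hx trivial
    · exact maximalIdeal_le_jacobson _
  exact (Submodule.subsingleton_iff R).1 (subsingleton_of_bot_eq_top h1.symm)

theorem quotSMulTop_right {x : R} (hreg : IsSMulRegular A x) {i : ℕ} (h : ExtZero R X A i)
    (h' : ExtZero R X A (i + 1)) : ExtZero R X (QuotSMulTop x A) i :=
  covariant_right (f := LinearMap.lsmul R A x) hreg (Submodule.mkQ_surjective _)
        (LinearMap.exact_lsmul_mkQ_smul_top A x) h h'

variable [IsLocalRing R]

theorem residue_smul_eq_zero {x : R} (hx : x ∈ maximalIdeal R) {i : ℕ}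
    (α : Abelian.Ext.{0} (ModuleCat.of R (R ⧸ maximalIdeal R)) (ModuleCat.of R A) i) :
    x • α = 0 := by
  rw [← mk₀_smul_comp, show LinearMap.lsmul R (R ⧸ maximalIdeal R) x = 0 from ?_]
  · rw [show ModuleCat.ofHom (0 : (R ⧸ maximalIdeal R) →ₗ[R] (R ⧸ maximalIdeal R)) = 0 from rfl,
      Abelian.Ext.mk₀_zero, Abelian.Ext.zero_comp]
  · ext
    simpa [Algebra.smul_def, Ideal.Quotient.eq_zero_iff_mem] using hx

theorem of_quotSMulTop_right {x : R} (hx : x ∈ maximalIdeal R) (hreg : IsSMulRegular A x) {i : ℕ}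
    (h : ExtZero R (R ⧸ maximalIdeal R) (QuotSMulTop x A) i) :
    ExtZero R (R ⧸ maximalIdeal R) A (i + 1) := by
  refine subsingleton_of_forall_eq 0 fun α => ?_
  obtain ⟨β, rfl⟩ := Abelian.Ext.covariant_sequence_exact₁ _
    (shortExact_ofLinearMap (f := LinearMap.lsmul R A x) hreg (Submodule.mkQ_surjective _)
        (LinearMap.exact_lsmul_mkQ_smul_top A x)) α
    ((comp_mk₀_smul α x).trans (residue_smul_eq_zero hx α)) rfl
  rw [h.elim β 0, Abelian.Ext.zero_comp]

end ExtZero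

theorem extZero_of_hasInjDimLE {n : ℕ} (hA : hasInjDimLE R n A) {i : ℕ} (hi : n < i) :
    ExtZero R X A i := by
  obtain ⟨i, rfl⟩ : ∃ j, i = j + 1 := ⟨i - 1, by omega⟩
  induction n generalizing A i with
  | zero => exact ExtZero.of_injective hA i
  | succ n ih =>
    obtain ⟨I, _, _, f, hI, hf, h⟩ := hA
    obtain ⟨i, rfl⟩ : ∃ j, i = j + 1 := ⟨i - 1, by omega⟩
    exact ExtZero.covariant_left hf (Submodule.mkQ_surjective _) (LinearMap.exact_map_mkQ_range f)
      (ih h i (by omega)) (.of_injective hI _)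

variable [IsLocalRing R]

/-- The depth of the module `Y` is at least `n`. -/
def DepthGE (R : Type) [CommRing R] [IsLocalRing R] (n : ℕ) (Y : Type) [AddCommGroup Y]
    [Module R Y] : Prop :=
  ∀ i < n, ExtZero R (R ⧸ maximalIdeal R) Y i

theorem le_moduleDepth_iff {n : ℕ} : (n : ℕ∞) ≤ moduleDepth R A ↔ DepthGE R n A := by
  simp only [moduleDepth, le_sInf_iff, DepthGE]
  constructor
  · intro h i hi
    by_contra h'
    rw [← subsingleton_extGroup_iff, not_subsingleton_iff_nontrivial] at h'
    have := h i ⟨i, rfl, h'⟩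
    exact absurd (by exact_mod_cast this) (not_le.2 hi)
  · rintro h _ ⟨j, rfl, hj⟩
    by_contra h'
    rw [← not_subsingleton_iff_nontrivial, subsingleton_extGroup_iff] at hj
    exact hj (h j (by exact_mod_cast not_le.1 h'))

theorem moduleDepth_eq_iff {n : ℕ} : moduleDepth R A = n ↔
    DepthGE R n A ∧ ¬ ExtZero R (R ⧸ maximalIdeal R) A n := by
  rw [← le_moduleDepth_iff]
  have h2 := le_moduleDepth_iff (R := R) (A := A) (n := n + 1)
  have h1 := le_moduleDepth_iff (R := R) (A := A) (n := n)
  constructor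
  · intro h
    refine ⟨h.ge, fun h' => ?_⟩
    have h3 : ((n + 1 : ℕ) : ℕ∞) ≤ moduleDepth R A := h2.2 fun i hi => by
      rcases Nat.lt_succ_iff_lt_or_eq.1 hi with hi | rfl
      · exact h1.1 h.ge i hi
      · exact h'
    rw [h] at h3
    exact absurd (by exact_mod_cast h3) (Nat.not_succ_le_self n)
  · rintro ⟨h, h'⟩
    refine le_antisymm ?_ h
    by_contra h3
    exact h' (h2.1 (by push_cast; exact Order.add_one_le_of_lt (not_le.1 h3)) n
      (Nat.lt_succ_self n))

namespace DepthGE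

theorem exists_isSMulRegular [IsNoetherianRing R] [Module.Finite R A] {n : ℕ}
    (h : DepthGE R (n + 1) A) : ∃ x ∈ maximalIdeal R, IsSMulRegular A x := by
  have := ExtZero.zero_iff.1 (h 0 (Nat.succ_pos n))
  rw [IsSMulRegular.subsingleton_linearMap_iff] at this
  simpa [Ideal.annihilator_quotient] using this

theorem quotSMulTop {n : ℕ} (h : DepthGE R (n + 1) A) {x : R} (hreg : IsSMulRegular A x) :
    DepthGE R n (QuotSMulTop x A) := fun i hi =>
  ExtZero.quotSMulTop_right hreg (h i (by omega)) (h (i + 1) (by omega))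

theorem mono {m n : ℕ} (hmn : m ≤ n) (h : DepthGE R n A) : DepthGE R m A :=
  fun i hi => h i (hi.trans_le hmn)

theorem zero : DepthGE R 0 A := fun _ h => absurd h (Nat.not_lt_zero _)

theorem of_subsingleton [Subsingleton A] (n : ℕ) : DepthGE R n A :=
  fun i _ => ExtZero.of_subsingleton_right i

theorem of_retract {n : ℕ} (f : A →ₗ[R] B) (g : B →ₗ[R] A) (h : g ∘ₗ f = LinearMap.id)
    (hB : DepthGE R n B) : DepthGE R n A :=
  fun i hi => (hB i hi).of_retract f g h

theorem of_equiv {n : ℕ} (e : A ≃ₗ[R] B) (hB : DepthGE R n B) : DepthGE R n A :=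
  fun i hi => (hB i hi).of_equiv_right e

section

variable {f : A →ₗ[R] B} {g : B →ₗ[R] C} (hf : Function.Injective f)
    (hg : Function.Surjective g) (h : Function.Exact f g) {n : ℕ}
include hf hg h

theorem left (hC : DepthGE R n C) (hB : DepthGE R (n + 1) B) : DepthGE R (n + 1) A := by
  rintro (_ | i) hi
  · exact ExtZero.covariant_left_zero hf hg h (hB 0 hi)
  · exact ExtZero.covariant_left hf hg h (hC i (by omega)) (hB _ hi)

theorem left' (hC : DepthGE R n C) (hB : DepthGE R n B) : DepthGE R n A := by
  cases n with
  | zero => exact zero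
  | succ n => exact left hf hg h (hC.mono n.le_succ) hB

theorem mid (hA : DepthGE R n A) (hC : DepthGE R n C) : DepthGE R n B :=
  fun i hi => ExtZero.covariant_mid hf hg h (hA i hi) (hC i hi)

end

end DepthGE

theorem injective_of_ne_zero_residue {B : Type} [AddCommGroup B] [Module R B]
    (φ : (R ⧸ maximalIdeal R) →ₗ[R] B) (hφ : φ ≠ 0) : Function.Injective φ := by
  rw [← LinearMap.ker_eq_bot]
  by_contra hne
  obtain ⟨x, hx, hx0⟩ := Submodule.exists_mem_ne_zero_of_ne_bot hne
  obtain ⟨r, rfl⟩ := Ideal.Quotient.mk_surjective x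
  have hr : IsUnit r := by
    by_contra hr
    exact hx0 (Ideal.Quotient.eq_zero_iff_mem.2 ((mem_maximalIdeal r).2 hr))
  apply hφ
  ext
  obtain ⟨u, rfl⟩ := hr
  have h1 : (u : R) • φ 1 = 0 := by
    rw [← map_smul, ← LinearMap.mem_ker.1 hx]
    simp [Algebra.smul_def]
  have := congrArg (fun z => (↑u⁻¹ : R) • z) h1
  simpa [smul_smul] using this

end Local

section Vanishing

variable {R : Type} [CommRing R] [IsNoetherianRing R] [IsLocalRing R]

/-- `Ext^i(L, ω)` vanishes for all finitely generated `L` and all `i > d`. -/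
def ExtVanishesAbove (R : Type) [CommRing R] (d : ℕ) (ω : Type) [AddCommGroup ω] [Module R ω] :
    Prop :=
  ∀ (L : Type) [AddCommGroup L] [Module R L] [Module.Finite R L] (i : ℕ), d < i → ExtZero R L ω i

/-- Cutting down by a regular sequence, a module of depth exactly `t` yields one of depth zero
for which the vanishing of `Ext(-, ω)` is shifted by `t`. -/
theorem exists_depth_zero_of_depthGE {ω : Type} [AddCommGroup ω] [Module R ω] (t s : ℕ)
    (B : Type) [AddCommGroup B] [Module R B] [Module.Finite R B]
    (hB : DepthGE R t B) (hB' : ¬ ExtZero R (R ⧸ maximalIdeal R) B t)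
    (h : ∀ i, s < i → ExtZero R B ω i) :
    ∃ (B' : Type) (_ : AddCommGroup B') (_ : Module R B') (_ : Module.Finite R B'),
      ¬ ExtZero R (R ⧸ maximalIdeal R) B' 0 ∧ ∀ i, s + t < i → ExtZero R B' ω i := by
  induction t generalizing B s with
  | zero => exact ⟨B, _, _, ‹_›, hB', h⟩
  | succ t ih =>
    obtain ⟨x, hx, hreg⟩ := hB.exists_isSMulRegular
    obtain ⟨B', i1, i2, i3, h1, h2⟩ := ih (s + 1) (QuotSMulTop x B) (hB.quotSMulTop hreg)
      (fun h0 => hB' (ExtZero.of_quotSMulTop_right hx hreg h0)) (by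
        intro i hi
        obtain ⟨i, rfl⟩ : ∃ j, i = j + 1 := ⟨i - 1, by omega⟩
        exact ExtZero.contravariant_right (f := LinearMap.lsmul R B x) hreg
          (Submodule.mkQ_surjective _) (LinearMap.exact_lsmul_mkQ_smul_top B x)
          (h i (by omega)) (h _ (by omega)))
    exact ⟨B', i1, i2, i3, h1, fun i hi => h2 i (by omega)⟩

theorem extVanishesAbove_of_hasInjDimLE {d : ℕ} (hR : DepthGE R d R)
    (hR' : ¬ ExtZero R (R ⧸ maximalIdeal R) R d) {ω : Type} [AddCommGroup ω] [Module R ω]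
    [Module.Finite R ω] {n : ℕ} (hω : hasInjDimLE R n ω) : ExtVanishesAbove R d ω := by
  suffices H : ∀ j i, d < i → n < i + j → ∀ (L : Type) [AddCommGroup L] [Module R L]
      [Module.Finite R L], ExtZero R L ω i from
    fun L _ _ _ i hi => H (n + 1) i hi (by omega) L
  intro j
  induction j with
  | zero => intro i _ hi L _ _ _; exact extZero_of_hasInjDimLE hω hi
  | succ j ih =>
    intro i hdi hij L _ _ _
    have ih' := ih (i + 1) (by omega) (by omega)
    obtain ⟨B', _, _, _, h1, h2⟩ := exists_depth_zero_of_depthGE (ω := ω) d 0 R hR hR'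
      (fun i hi => by
        obtain ⟨i, rfl⟩ : ∃ j, i = j + 1 := ⟨i - 1, by omega⟩
        exact ExtZero.of_projective i)
    have hk : ExtZero R (R ⧸ maximalIdeal R) ω i := by
      rw [ExtZero.zero_iff, not_subsingleton_iff_nontrivial] at h1
      obtain ⟨φ, hφ⟩ := exists_ne (0 : (R ⧸ maximalIdeal R) →ₗ[R] B')
      exact ExtZero.contravariant_left (injective_of_ne_zero_residue φ hφ)
        (Submodule.mkQ_surjective _) (LinearMap.exact_map_mkQ_range φ)
        (h2 i (by omega)) (ih' _)
    have hprime (p : PrimeSpectrum R) : ExtZero R (R ⧸ p.asIdeal) ω i := by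
      by_cases hp : maximalIdeal R ≤ p.asIdeal
      · have : p.asIdeal = maximalIdeal R :=
          ((maximalIdeal.isMaximal R).eq_of_le p.2.ne_top hp).symm
        rw [this]
        exact hk
      · obtain ⟨x, hx, hxp⟩ := SetLike.not_le_iff_exists.1 hp
        refine ExtZero.of_quotSMulTop_left hx ?_ (ih' _)
        rw [isSMulRegular_iff_right_eq_zero_of_smul]
        intro y hy
        have hx0 : Ideal.Quotient.mk p.asIdeal x ≠ 0 := by
          rwa [Ne, Ideal.Quotient.eq_zero_iff_mem]
        rw [Algebra.smul_def] at hy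
        exact (mul_eq_zero.1 hy).resolve_left hx0
    induction ‹Module.Finite R L› using IsNoetherianRing.induction_on_isQuotientEquivQuotientPrime R
      with
    | subsingleton N => exact ExtZero.of_subsingleton_left i
    | quotient N p e => exact (hprime p).of_equiv_left e
    | exact N₁ N₂ N₃ f g hf hg hfg h₁ h₃ => exact ExtZero.contravariant_mid hf hg hfg h₁ h₃

namespace ExtVanishesAbove

variable {d : ℕ} {ω : Type} [AddCommGroup ω] [Module R ω] [Module.Finite R ω]

theorem extZero_of_depthGE (hω : ExtVanishesAbove R d ω) {t : ℕ} {Y : Type} [AddCommGroup Y]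
    [Module R Y] [Module.Finite R Y] (hY : DepthGE R t Y) {i : ℕ} (hi : d < i + t) :
    ExtZero R Y ω i := by
  induction t generalizing Y i with
  | zero => exact hω Y i hi
  | succ t ih =>
    obtain ⟨x, hx, hreg⟩ := hY.exists_isSMulRegular
    exact ExtZero.of_quotSMulTop_left hx hreg (ih (hY.quotSMulTop hreg) (by omega))

theorem extZero_of_depthGE_dim (hω : ExtVanishesAbove R d ω) {Y : Type} [AddCommGroup Y]
    [Module R Y] [Module.Finite R Y] (hY : DepthGE R d Y) (i : ℕ) : ExtZero R Y ω (i + 1) :=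
  hω.extZero_of_depthGE hY (by omega)

end ExtVanishesAbove

end Vanishing

section Duality

variable {R : Type} [CommRing R]

/-- The formal properties of the predicates expressing depth at least `n`. -/
structure IsDepthLike (R : Type) [CommRing R]
    (P : ℕ → ∀ (Y : Type) [AddCommGroup Y] [Module R Y], Prop) : Prop where
  zero : ∀ (Y : Type) [AddCommGroup Y] [Module R Y], P 0 Y
  of_subsingleton : ∀ (n : ℕ) (Y : Type) [AddCommGroup Y] [Module R Y] [Subsingleton Y], P n Y
  of_equiv : ∀ (n : ℕ) {A B : Type} [AddCommGroup A] [Module R A] [AddCommGroup B] [Module R B],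
    (A ≃ₗ[R] B) → P n B → P n A
  left : ∀ (n : ℕ) {A B C : Type} [AddCommGroup A] [Module R A] [AddCommGroup B] [Module R B]
    [AddCommGroup C] [Module R C] (f : A →ₗ[R] B) (g : B →ₗ[R] C), Function.Injective f →
    Function.Surjective g → Function.Exact f g → P n C → P (n + 1) B → P (n + 1) A
  mid : ∀ (n : ℕ) {A B C : Type} [AddCommGroup A] [Module R A] [AddCommGroup B] [Module R B]
    [AddCommGroup C] [Module R C] (f : A →ₗ[R] B) (g : B →ₗ[R] C), Function.Injective f →
    Function.Surjective g → Function.Exact f g → P n A → P n C → P n B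

theorem isDepthLike_depthGE [IsLocalRing R] :
    IsDepthLike R (fun n Y _ _ => DepthGE R n Y) where
  zero _ _ _ := .zero
  of_subsingleton n _ _ _ _ := .of_subsingleton n
  of_equiv _ _ _ _ _ _ _ e h := h.of_equiv e
  left _ _ _ _ _ _ _ _ _ _ _ _ hf hg h h1 h2 := .left hf hg h h1 h2
  mid _ _ _ _ _ _ _ _ _ _ _ _ hf hg h h1 h2 := .mid hf hg h h1 h2

theorem isDepthLike_depthGE_localization (p : Ideal R) [p.IsPrime] :
    IsDepthLike R (fun n Y _ _ =>
      DepthGE (Localization.AtPrime p) n (LocalizedModule p.primeCompl Y)) where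
  zero _ _ _ := .zero
  of_subsingleton n _ _ _ _ := .of_subsingleton n
  of_equiv n A B _ _ _ _ e h := by
    refine h.of_equiv (LinearEquiv.ofBijective (LocalizedModule.map p.primeCompl e.toLinearMap) ?_)
    exact ⟨LocalizedModule.map_injective _ _ e.injective,
      LocalizedModule.map_surjective _ _ e.surjective⟩
  left n A B C _ _ _ _ _ _ f g hf hg h h1 h2 := .left (LocalizedModule.map_injective _ _ hf)
    (LocalizedModule.map_surjective _ _ hg) (LocalizedModule.map_exact _ _ _ h) h1 h2
  mid n A B C _ _ _ _ _ _ f g hf hg h h1 h2 := .mid (LocalizedModule.map_injective _ _ hf)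
    (LocalizedModule.map_surjective _ _ hg) (LocalizedModule.map_exact _ _ _ h) h1 h2

theorem IsDepthLike.pi {P : ℕ → ∀ (Y : Type) [AddCommGroup Y] [Module R Y], Prop}
    (hP : IsDepthLike R P) {n : ℕ} {Y : Type} [AddCommGroup Y] [Module R Y] (h : P n Y) (a : ℕ) :
    P n (Fin a → Y) := by
  induction a with
  | zero => exact hP.of_subsingleton n _
  | succ a ih =>
    refine hP.mid n (LinearMap.single R (fun _ : Fin (a + 1) => Y) 0)
      (LinearMap.funLeft R Y Fin.succ) (fun y z hyz => by simpa using congrFun hyz 0) ?_ ?_ h ih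
    · exact LinearMap.funLeft_surjective_of_injective _ _ _ (Fin.succ_injective _)
    · intro v
      constructor
      · intro hv
        refine ⟨v 0, ?_⟩
        ext i
        refine Fin.cases ?_ (fun j => ?_) i
        · simp
        · simpa using (congrFun hv j).symm
      · rintro ⟨y, rfl⟩
        ext j
        simp [LinearMap.funLeft]

variable [IsLocalRing R]

theorem DepthGE.pi {n : ℕ} {Y : Type} [AddCommGroup Y] [Module R Y] (h : DepthGE R n Y) (a : ℕ) :
    DepthGE R n (Fin a → Y) := isDepthLike_depthGE.pi h a

/-- Kernels of surjections between free modules and modules of depth at least `d = depth R`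
again have depth at least `d`. -/
theorem DepthGE.ker {d : ℕ} {A B : Type} [AddCommGroup A] [Module R A] [AddCommGroup B]
    [Module R B] (hA : DepthGE R d A) (hB : DepthGE R d B) {f : A →ₗ[R] B}
    (hf : Function.Surjective f) : DepthGE R d (LinearMap.ker f) :=
  .left' (Submodule.subtype_injective _) hf f.exact_subtype_ker_map hB hA

variable [IsNoetherianRing R] {d : ℕ} {ω : Type} [AddCommGroup ω] [Module R ω] [Module.Finite R ω]

section ShortExact

variable {A B C : Type} [AddCommGroup A] [Module R A] [AddCommGroup B] [Module R B]
  [AddCommGroup C] [Module R C] [Module.Finite R C]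

theorem ExtVanishesAbove.lcomp_surjective (hω : ExtVanishesAbove R d ω) (hC : DepthGE R d C)
    {f : A →ₗ[R] B} {g : B →ₗ[R] C} (hf : Function.Injective f) (hg : Function.Surjective g)
    (h : Function.Exact f g) : Function.Surjective (LinearMap.lcomp R ω f) :=
  ExtZero.exists_extension hf hg h (hω.extZero_of_depthGE_dim hC 0)

end ShortExact

/-- The dual of a maximal Cohen–Macaulay module has as much depth as `ω` has. -/
theorem IsDepthLike.dual {P : ℕ → ∀ (Y : Type) [AddCommGroup Y] [Module R Y], Prop}
    (hP : IsDepthLike R P) (hω : ExtVanishesAbove R d ω) (hR : DepthGE R d R) {n : ℕ}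
    (hn : ∀ m ≤ n, P m ω) {V : Type} [AddCommGroup V] [Module R V] [Module.Finite R V]
    (hV : DepthGE R d V) : P n (V →ₗ[R] ω) := by
  induction n generalizing V with
  | zero => exact hP.zero _
  | succ n ih =>
    obtain ⟨a, π, hπ⟩ := Module.Finite.exists_fin' R V
    refine hP.left n (LinearMap.lcomp R ω π) (LinearMap.lcomp R ω (LinearMap.ker π).subtype)
      (LinearMap.lcomp_injective_of_surjective _ hπ) 
      (hω.lcomp_surjective hV (Submodule.subtype_injective _) hπ π.exact_subtype_ker_map)
      (LinearMap.exact_lcomp_of_exact_of_surjective _ π.exact_subtype_ker_map hπ)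
      (ih (fun m hm => hn m (by omega)) ((hR.pi a).ker hV hπ)) ?_
    exact hP.of_equiv _ ((LinearMap.lsum R (fun _ : Fin a => R) R).symm ≪≫ₗ LinearEquiv.piCongrRight
      fun _ => LinearMap.ringLmapEquivSelf R R ω) (hP.pi (hn _ le_rfl) a)

theorem DepthGE.dual (hω : ExtVanishesAbove R d ω) (hR : DepthGE R d R) (hω' : DepthGE R d ω)
    {V : Type} [AddCommGroup V] [Module R V] [Module.Finite R V]
    (hV : DepthGE R d V) : DepthGE R d (V →ₗ[R] ω) :=
  isDepthLike_depthGE.dual hω hR (fun _ hm => hω'.mono hm) hV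

/-- If `A`, `B` and the cokernel of `g : A → B` are maximal Cohen–Macaulay, so is the cokernel
of the dual map. -/
theorem DepthGE.coker_lcomp (hω : ExtVanishesAbove R d ω) (hR : DepthGE R d R)
    (hω' : DepthGE R d ω) {A B : Type} [AddCommGroup A] [Module R A] [Module.Finite R A]
    [AddCommGroup B] [Module R B] [Module.Finite R B] (g : A →ₗ[R] B) (hA : DepthGE R d A)
    (hB : DepthGE R d B) (hC : DepthGE R d (B ⧸ LinearMap.range g)) :
    DepthGE R d ((A →ₗ[R] ω) ⧸ LinearMap.range (LinearMap.lcomp R ω g)) := by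
  have hI : DepthGE R d (LinearMap.range g) := .left' (Submodule.subtype_injective _)
    (Submodule.mkQ_surjective _) (LinearMap.exact_subtype_mkQ _) hC hB
  have hsurj := g.surjective_rangeRestrict
  have hexact : Function.Exact (LinearMap.ker g).subtype g.rangeRestrict := by
    rw [LinearMap.exact_iff, Submodule.range_subtype, LinearMap.ker_rangeRestrict]
  have hK : DepthGE R d (LinearMap.ker g) :=
    .left' (Submodule.subtype_injective _) hsurj hexact hI hA
  have hρ : Function.Surjective (LinearMap.lcomp R ω (LinearMap.ker g).subtype) :=
    hω.lcomp_surjective hI (Submodule.subtype_injective _) hsurj hexact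
  have hker : LinearMap.range (LinearMap.lcomp R ω g) =
      LinearMap.ker (LinearMap.lcomp R ω (LinearMap.ker g).subtype) := by
    apply le_antisymm
    · rintro _ ⟨φ, rfl⟩
      ext x
      simp
    · intro φ hφ
      obtain ⟨φ', rfl⟩ := ((LinearMap.exact_lcomp_of_exact_of_surjective _ hexact hsurj) φ).1 hφ
      obtain ⟨ψ, rfl⟩ := hω.lcomp_surjective hC (Submodule.subtype_injective _)
        (Submodule.mkQ_surjective _) (LinearMap.exact_subtype_mkQ _) φ'
      exact ⟨ψ, rfl⟩
  exact (DepthGE.dual hω hR hω' hK).of_equiv (Submodule.quotEquivOfEq _ _ hker ≪≫ₗ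
    LinearMap.quotKerEquivOfSurjective _ hρ)

end Duality

section Biduality

variable {R : Type} [CommRing R]

/-- The evaluation map `End(ω) ⊗ X → Hom(Hom(X, ω), ω)`, `s ⊗ x ↦ (φ ↦ s (φ x))`. -/
def biduality (R : Type) [CommRing R] (ω : Type) [AddCommGroup ω] [Module R ω] (X : Type)
    [AddCommGroup X] [Module R X] : (ω →ₗ[R] ω) ⊗[R] X →ₗ[R] ((X →ₗ[R] ω) →ₗ[R] ω) :=
  TensorProduct.lift (LinearMap.mk₂ R (fun s x => s ∘ₗ LinearMap.applyₗ x)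
    (fun _ _ _ => by ext; simp) (fun _ _ _ => by ext; simp) (fun _ _ _ => by ext; simp)
    (fun _ _ _ => by ext; simp))

variable {ω : Type} [AddCommGroup ω] [Module R ω] {X Y : Type} [AddCommGroup X] [Module R X]
  [AddCommGroup Y] [Module R Y]

@[simp]
theorem biduality_tmul (s : ω →ₗ[R] ω) (x : X) (φ : X →ₗ[R] ω) :
    biduality R ω X (s ⊗ₜ x) φ = s (φ x) := rfl

theorem biduality_lTensor (f : X →ₗ[R] Y) (z : (ω →ₗ[R] ω) ⊗[R] X) :
    biduality R ω Y (f.lTensor _ z) = LinearMap.lcomp R ω (LinearMap.lcomp R ω f)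
      (biduality R ω X z) := by
  have : biduality R ω Y ∘ₗ f.lTensor _ = LinearMap.lcomp R ω (LinearMap.lcomp R ω f) ∘ₗ
      biduality R ω X := by
    ext; simp
  exact LinearMap.congr_fun this z

theorem biduality_bijective_pi (a : ℕ) : Function.Bijective (biduality R ω (Fin a → R)) := by
  let c (i : Fin a) : ω →ₗ[R] ((Fin a → R) →ₗ[R] ω) :=
    LinearMap.mk₂ R (fun w f => f i • w) (fun _ _ _ => by simp) (fun r w f => smul_comm _ _ _)
      (fun _ _ _ => by simp [add_smul]) (fun _ _ _ => by simp [mul_smul])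
  let ψ : (((Fin a → R) →ₗ[R] ω) →ₗ[R] ω) →ₗ[R] (ω →ₗ[R] ω) ⊗[R] (Fin a → R) :=
    ∑ i, (TensorProduct.mk R (ω →ₗ[R] ω) (Fin a → R)).flip (Pi.single i 1) ∘ₗ
      LinearMap.lcomp R ω (c i)
  have hψ θ : ψ θ = ∑ i, (θ ∘ₗ c i) ⊗ₜ[R] (Pi.single i (1 : R) : Fin a → R) := by
    simp [ψ]
    rfl
  constructor
  · have : ψ ∘ₗ biduality R ω (Fin a → R) = LinearMap.id := by
      refine TensorProduct.ext' fun s x => ?_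
      simp only [LinearMap.comp_apply, hψ, LinearMap.id_apply]
      have h1 (i : Fin a) : biduality R ω (Fin a → R) (s ⊗ₜ x) ∘ₗ c i = x i • s := by
        ext w
        simp [c]
      simp only [h1, TensorProduct.smul_tmul, ← TensorProduct.tmul_sum]
      congr 1
      simpa using (pi_eq_sum_univ' x).symm
    exact Function.LeftInverse.injective (LinearMap.congr_fun this)
  · intro θ
    refine ⟨ψ θ, ?_⟩
    ext φ
    rw [hψ, map_sum, LinearMap.sum_apply]
    simp only [biduality_tmul, LinearMap.comp_apply, ← map_sum]
    congr 1
    ext f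
    simp [c, Pi.single_apply]

variable [IsNoetherianRing R] [IsLocalRing R] {d : ℕ} [Module.Finite R ω]

section

variable (hω : ExtVanishesAbove R d ω) (hR : DepthGE R d R) (hω' : DepthGE R d ω)
  [Module.Finite R X] (hX : DepthGE R d X)
include hω hR hω' hX

theorem lcomp_lcomp_surjective [Module.Finite R Y] (hY : DepthGE R d Y) {π : Y →ₗ[R] X}
    (hπ : Function.Surjective π) :
    Function.Surjective (LinearMap.lcomp R ω (LinearMap.lcomp R ω π)) := by
  refine hω.lcomp_surjective (DepthGE.dual hω hR hω' (hY.ker hX hπ))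
    (g := LinearMap.lcomp R ω (LinearMap.ker π).subtype)
    (LinearMap.lcomp_injective_of_surjective _ hπ)
    (hω.lcomp_surjective hX (Submodule.subtype_injective _) hπ π.exact_subtype_ker_map)
    (LinearMap.exact_lcomp_of_exact_of_surjective _ π.exact_subtype_ker_map hπ)

theorem biduality_surjective : Function.Surjective (biduality R ω X) := by
  obtain ⟨a, π, hπ⟩ := Module.Finite.exists_fin' R X
  intro θ
  obtain ⟨θ, rfl⟩ := lcomp_lcomp_surjective hω hR hω' hX (hR.pi a) hπ θ
  obtain ⟨z, rfl⟩ := (biduality_bijective_pi a).2 θ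
  exact ⟨π.lTensor _ z, biduality_lTensor π z⟩

theorem biduality_injective : Function.Injective (biduality R ω X) := by
  rw [injective_iff_map_eq_zero]
  intro z hz
  obtain ⟨a, π, hπ⟩ := Module.Finite.exists_fin' R X
  obtain ⟨y, rfl⟩ := LinearMap.lTensor_surjective _ hπ z
  rw [biduality_lTensor] at hz
  obtain ⟨θ, hθ⟩ := ((LinearMap.exact_lcomp_of_exact_of_surjective ω
    (LinearMap.exact_lcomp_of_exact_of_surjective ω π.exact_subtype_ker_map hπ)
    (hω.lcomp_surjective hX (Submodule.subtype_injective _) hπ π.exact_subtype_ker_map)) _).1 hz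
  obtain ⟨w, rfl⟩ := biduality_surjective hω hR hω' ((hR.pi a).ker hX hπ) θ
  rw [← biduality_lTensor] at hθ
  rw [← (biduality_bijective_pi a).1 hθ]
  exact (lTensor_exact _ π.exact_subtype_ker_map hπ).apply_apply_eq_zero w

/-- Tensoring with `End(ω)` is exact on syzygy sequences of maximal Cohen–Macaulay modules. -/
theorem lTensor_end_injective {a : ℕ} {π : (Fin a → R) →ₗ[R] X} (hπ : Function.Surjective π) :
    Function.Injective ((LinearMap.ker π).subtype.lTensor (ω →ₗ[R] ω)) := by
  rw [injective_iff_map_eq_zero]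
  intro z hz
  have hK := (hR.pi a).ker hX hπ
  apply biduality_injective hω hR hω' hK
  have h1 := biduality_lTensor (ω := ω) (LinearMap.ker π).subtype z
  rw [hz, map_zero] at h1
  rw [map_zero]
  exact LinearMap.lcomp_injective_of_surjective _
    (hω.lcomp_surjective hX (Submodule.subtype_injective _) hπ π.exact_subtype_ker_map)
    (h1.symm.trans (map_zero _).symm)

end

end Biduality

section Free

variable {R : Type} [CommRing R]

section

variable {A' G A B' F B : Type} [AddCommGroup A'] [Module R A'] [AddCommGroup G] [Module R G]
  [AddCommGroup A] [Module R A] [AddCommGroup B'] [Module R B'] [AddCommGroup F] [Module R F]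
  [AddCommGroup B] [Module R B]

/-- Symmetry of the vanishing of `Tor₁(A, B)`, in terms of presentations. -/
theorem rTensor_injective_of_lTensor_injective [Module.Flat R F] {i : A' →ₗ[R] G} {p : G →ₗ[R] A}
    {j : B' →ₗ[R] F} {q : F →ₗ[R] B} (hi : Function.Injective i) (hp : Function.Surjective p)
    (hip : Function.Exact i p) (hq : Function.Surjective q) (hjq : Function.Exact j q)
    (h : Function.Injective (j.lTensor A)) : Function.Injective (i.rTensor B) := by
  rw [injective_iff_map_eq_zero]
  intro z hz
  obtain ⟨y, rfl⟩ := LinearMap.lTensor_surjective A' hq z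
  have hcomm {P Q P' Q' : Type} [AddCommGroup P] [Module R P] [AddCommGroup Q] [Module R Q]
      [AddCommGroup P'] [Module R P'] [AddCommGroup Q'] [Module R Q'] (u : P →ₗ[R] Q)
      (v : P' →ₗ[R] Q') (x : P ⊗[R] P') :
      u.rTensor Q' (v.lTensor P x) = v.lTensor Q (u.rTensor P' x) := by
    rw [← LinearMap.comp_apply, ← LinearMap.comp_apply, LinearMap.rTensor_comp_lTensor,
      LinearMap.lTensor_comp_rTensor]
  rw [hcomm] at hz
  obtain ⟨w, hw⟩ := (lTensor_exact G hjq hq _).1 hz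
  have hw0 : p.rTensor B' w = 0 := by
    apply h
    rw [map_zero, ← hcomm, hw]
    exact (rTensor_exact F hip hp).apply_apply_eq_zero y
  obtain ⟨v, rfl⟩ := (rTensor_exact B' hip hp w).1 hw0
  rw [← hcomm] at hw
  rw [← Module.Flat.rTensor_preserves_injective_linearMap i hi hw]
  exact (lTensor_exact A' hjq hq).apply_apply_eq_zero v

end

/-- `Tor₁(S, X) = 0`, in terms of finite free presentations of `X`. -/
def TorVanishes (R : Type) [CommRing R] (S X : Type) [AddCommGroup S] [Module R S]
    [AddCommGroup X] [Module R X] : Prop :=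
  ∀ (a : ℕ) (π : (Fin a → R) →ₗ[R] X), Function.Surjective π →
    Function.Injective ((LinearMap.ker π).subtype.lTensor S)

variable {S X : Type} [AddCommGroup S] [Module R S] [AddCommGroup X] [Module R X]

theorem TorVanishes.shift {a b : ℕ} {σ : (Fin a → R) →ₗ[R] S} {π : (Fin b → R) →ₗ[R] X}
    [Module.Finite R (LinearMap.ker π)]
    (hσ : Function.Surjective σ) (h : TorVanishes R S (LinearMap.ker π)) :
    Function.Injective ((LinearMap.ker π).subtype.lTensor (LinearMap.ker σ)) := by
  obtain ⟨c, τ, hτ⟩ := Module.Finite.exists_fin' R (LinearMap.ker π)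
  have h1 := rTensor_injective_of_lTensor_injective (Submodule.subtype_injective _) hσ
    σ.exact_subtype_ker_map hτ τ.exact_subtype_ker_map (h c τ hτ)
  have h2 := Module.Flat.lTensor_preserves_injective_linearMap (M := Fin a → R) _
    (Submodule.subtype_injective (LinearMap.ker π))
  have h3 := h2.comp h1
  rw [← LinearMap.coe_comp, LinearMap.lTensor_comp_rTensor, ← LinearMap.rTensor_comp_lTensor,
    LinearMap.coe_comp] at h3
  exact h3.of_comp

variable [IsLocalRing R]

theorem eq_zero_of_comp_mem_smul {A : Type} [AddCommGroup A] [Module R A] {f : X →ₗ[R] A}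
    (hf : f ∈ maximalIdeal R • (⊤ : Submodule R (X →ₗ[R] A))) {i : ℕ}
    (α : Abelian.Ext.{0} (ModuleCat.of R (R ⧸ maximalIdeal R)) (ModuleCat.of R X) i) :
    α.comp (Abelian.Ext.mk₀ (ModuleCat.ofHom f)) (add_zero i) = 0 := by
  induction hf using Submodule.smul_induction_on' with
  | smul r hr g _ =>
    rw [show ModuleCat.ofHom (r • g) = r • ModuleCat.ofHom g from rfl, Abelian.Ext.mk₀_smul,
      Abelian.Ext.comp_smul, ← Abelian.Ext.smul_comp, ExtZero.residue_smul_eq_zero hr,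
      Abelian.Ext.zero_comp]
  | add g _ h _ hg hh =>
    rw [show ModuleCat.ofHom (g + h) = ModuleCat.ofHom g + ModuleCat.ofHom h from rfl,
      Abelian.Ext.mk₀_add, Abelian.Ext.comp_add, hg, hh, add_zero]

theorem DepthGE.eq_zero_of_comp {A B C : Type} [AddCommGroup A] [Module R A] [AddCommGroup B]
    [Module R B] [AddCommGroup C] [Module R C] {f : A →ₗ[R] B} {g : B →ₗ[R] C}
    (hf : Function.Injective f) (hg : Function.Surjective g) (h : Function.Exact f g) {d : ℕ}
    (hC : DepthGE R d C)
    (α : Abelian.Ext.{0} (ModuleCat.of R (R ⧸ maximalIdeal R)) (ModuleCat.of R A) d)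
    (hα : α.comp (Abelian.Ext.mk₀ (ModuleCat.ofHom f)) (add_zero d) = 0) : α = 0 := by
  cases d with
  | zero =>
    have := (shortExact_ofLinearMap hf hg h).mono_f
    refine Abelian.Ext.postcomp_mk₀_injective_of_mono _
      (ModuleCat.shortComplexOfCompEqZero f g h.linearMap_comp_eq_zero).f ?_
    rw [map_zero]
    exact hα
  | succ d =>
    obtain ⟨β, rfl⟩ := Abelian.Ext.covariant_sequence_exact₁ _ (shortExact_ofLinearMap hf hg h) α
      hα rfl
    rw [(hC d d.lt_succ_self).elim β 0, Abelian.Ext.zero_comp]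

/-- A maximal Cohen–Macaulay module of projective dimension at most one is free. -/
theorem free_of_free_ker {d : ℕ} (hR' : ¬ ExtZero R (R ⧸ maximalIdeal R) R d)
    (hS : DepthGE R d S) {a : ℕ} {σ : (Fin a → R) →ₗ[R] S} (hσ : Function.Surjective σ)
    [Module.Finite R (LinearMap.ker σ)] [Module.Free R (LinearMap.ker σ)] : Module.Free R S := by
  refine Module.free_of_lTensor_residueField_injective (LinearMap.ker σ).subtype σ hσ
    σ.exact_subtype_ker_map ?_
  rw [injective_iff_map_eq_zero]
  intro z hz
  have hsurj (z : ResidueField R ⊗[R] LinearMap.ker σ) :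
      ∃ v, z = (1 : ResidueField R) ⊗ₜ[R] v := by
    induction z with
    | zero => exact ⟨0, by simp⟩
    | tmul c v =>
      obtain ⟨r, rfl⟩ := residue_surjective c
      refine ⟨r • v, ?_⟩
      rw [TensorProduct.tmul_smul, TensorProduct.smul_tmul', Algebra.smul_def, mul_one]
      rfl
    | add x y hx hy =>
      obtain ⟨v, rfl⟩ := hx
      obtain ⟨w, rfl⟩ := hy
      exact ⟨v + w, (TensorProduct.tmul_add _ _ _).symm⟩
  obtain ⟨v, rfl⟩ := hsurj z
  by_contra hv0
  have hw (i : Fin a) : (v : Fin a → R) i ∈ maximalIdeal R := by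
    have h1 := congrArg (TensorProduct.rid R (ResidueField R))
      (congrArg ((LinearMap.proj (R := R) i).lTensor (ResidueField R)) hz)
    simp only [LinearMap.lTensor_tmul, map_zero, Submodule.subtype_apply, LinearMap.proj_apply,
      TensorProduct.rid_tmul, Algebra.smul_def, mul_one] at h1
    exact (residue_eq_zero_iff _).1 h1
  let b := Module.Free.chooseBasis R (LinearMap.ker σ)
  obtain ⟨i, hi⟩ : ∃ i, IsUnit (b.repr v i) := by
    by_contra! hi
    apply hv0
    rw [← b.sum_repr v, TensorProduct.tmul_sum]
    refine Finset.sum_eq_zero fun i _ => ?_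
    rw [TensorProduct.tmul_smul, TensorProduct.smul_tmul', Algebra.smul_def, mul_one]
    have : algebraMap R (ResidueField R) (b.repr v i) = 0 :=
      (residue_eq_zero_iff _).2 ((mem_maximalIdeal _).2 (hi i))
    rw [this, TensorProduct.zero_tmul]
  obtain ⟨u, hu⟩ := hi
  apply hR'
  refine subsingleton_of_forall_eq 0 fun α => ?_
  let j : R →ₗ[R] LinearMap.ker σ := LinearMap.toSpanSingleton R _ v
  let l : LinearMap.ker σ →ₗ[R] R := (↑u⁻¹ : R) • b.coord i
  have hlj : l ∘ₗ j = LinearMap.id := by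
    ext
    simp [l, j, ← hu]
  have h1 : α.comp (Abelian.Ext.mk₀ (ModuleCat.ofHom j)) (add_zero d) = 0 := by
    refine DepthGE.eq_zero_of_comp (Submodule.subtype_injective _) hσ σ.exact_subtype_ker_map
      hS _ ?_
    rw [Abelian.Ext.comp_assoc_of_third_deg_zero, Abelian.Ext.mk₀_comp_mk₀, ← ModuleCat.ofHom_comp]
    apply eq_zero_of_comp_mem_smul
    have : (LinearMap.ker σ).subtype ∘ₗ j =
        ∑ i, (v : Fin a → R) i • LinearMap.single R (fun _ : Fin a => R) i := by
      ext k
      simp [j, Finset.sum_apply, Pi.single_apply]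
    rw [this]
    exact Submodule.sum_mem _ fun i _ => Submodule.smul_mem_smul (hw i) trivial
  have h2 : α = (α.comp (Abelian.Ext.mk₀ (ModuleCat.ofHom j)) (add_zero d)).comp
      (Abelian.Ext.mk₀ (ModuleCat.ofHom l)) (add_zero d) := by
    rw [Abelian.Ext.comp_assoc_of_third_deg_zero, Abelian.Ext.mk₀_comp_mk₀, ← ModuleCat.ofHom_comp,
      hlj, ModuleCat.ofHom_id, Abelian.Ext.comp_mk₀_id]
  rw [h2, h1, Abelian.Ext.zero_comp]

/-- A maximal Cohen–Macaulay module which is Tor-independent of the modules of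
depth at least `e` is free. -/
theorem free_of_torVanishes [IsNoetherianRing R] {d : ℕ} (hR : DepthGE R d R)
    (hR' : ¬ ExtZero R (R ⧸ maximalIdeal R) R d) {e : ℕ} (he : e ≤ d) [Module.Finite R S]
    (hS : DepthGE R d S)
    (h : ∀ (X : Type) [AddCommGroup X] [Module R X] [Module.Finite R X], DepthGE R e X →
      TorVanishes R S X) : Module.Free R S := by
  induction e generalizing S with
  | zero =>
    obtain ⟨a, σ, hσ⟩ := Module.Finite.exists_fin' R S
    obtain ⟨b, π, hπ⟩ := Module.Finite.exists_fin' R (ResidueField R)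
    have h1 := rTensor_injective_of_lTensor_injective (Submodule.subtype_injective _) hσ
      σ.exact_subtype_ker_map hπ π.exact_subtype_ker_map (h (ResidueField R) .zero b π hπ)
    refine Module.free_of_lTensor_residueField_injective (LinearMap.ker σ).subtype σ hσ
      σ.exact_subtype_ker_map ?_
    exact (LinearMap.lTensor_inj_iff_rTensor_inj _ _).2 h1
  | succ e ih =>
    obtain ⟨a, σ, hσ⟩ := Module.Finite.exists_fin' R S
    have : Module.Free R (LinearMap.ker σ) := by
      refine ih (by omega) ((hR.pi a).ker hS hσ) fun X _ _ _ hX b π hπ => ?_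
      refine TorVanishes.shift hσ (h _ ?_)
      exact .left (Submodule.subtype_injective _) hπ π.exact_subtype_ker_map hX
        ((hR.pi b).mono he)
    exact free_of_free_ker hR' hS hσ

end Free

section Retract

variable {R : Type} [CommRing R] [IsNoetherianRing R] [IsLocalRing R] {d : ℕ} {ω : Type}
  [AddCommGroup ω] [Module R ω] [Module.Finite R ω]
  (hω : ExtVanishesAbove R d ω) (hR : DepthGE R d R)
  (hR' : ¬ ExtZero R (R ⧸ maximalIdeal R) R d) (hω' : DepthGE R d ω)
include hω hR hR' hω'

theorem free_end : Module.Free R (ω →ₗ[R] ω) :=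
  free_of_torVanishes hR hR' le_rfl (DepthGE.dual hω hR hω' hω') fun _ _ _ _ hX _ _ hπ =>
    lTensor_end_injective hω hR hω' hX hπ

/-- Every module `X` is a retract of `End(ω) ⊗ X`. -/
theorem exists_retract_end_tensor [Nontrivial ω] (X : Type) [AddCommGroup X] [Module R X] :
    ∃ (f : X →ₗ[R] (ω →ₗ[R] ω) ⊗[R] X) (g : (ω →ₗ[R] ω) ⊗[R] X →ₗ[R] X),
      g ∘ₗ f = LinearMap.id := by
  have := free_end hω hR hR' hω'
  let b := Module.Free.chooseBasis R (ω →ₗ[R] ω)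
  obtain ⟨i⟩ := b.index_nonempty
  refine ⟨TensorProduct.mk R _ X (b i), TensorProduct.lid R X ∘ₗ (b.coord i).rTensor X, ?_⟩
  ext x
  simp

/-- Maximal Cohen–Macaulay modules are retracts of their biduals. -/
theorem exists_retract_bidual [Nontrivial ω] (X : Type) [AddCommGroup X] [Module R X]
    [Module.Finite R X] (hX : DepthGE R d X) :
    ∃ (f : X →ₗ[R] ((X →ₗ[R] ω) →ₗ[R] ω)) (g : ((X →ₗ[R] ω) →ₗ[R] ω) →ₗ[R] X),
      g ∘ₗ f = LinearMap.id := by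
  obtain ⟨f, g, h⟩ := exists_retract_end_tensor hω hR hR' hω' X
  let e := LinearEquiv.ofBijective (biduality R ω X)
    ⟨biduality_injective hω hR hω' hX, biduality_surjective hω hR hω' hX⟩
  refine ⟨e ∘ₗ f, g ∘ₗ e.symm, ?_⟩
  rw [← h]
  ext x
  simp

/-- Converse of `DepthGE.coker_lcomp`. -/
theorem DepthGE.of_coker_lcomp [Nontrivial ω] {A B : Type} [AddCommGroup A] [Module R A]
    [Module.Finite R A]
    [AddCommGroup B] [Module R B] [Module.Finite R B] (g : A →ₗ[R] B) (hA : DepthGE R d A)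
    (hB : DepthGE R d B)
    (hC : DepthGE R d ((A →ₗ[R] ω) ⧸ LinearMap.range (LinearMap.lcomp R ω g))) :
    DepthGE R d (B ⧸ LinearMap.range g) := by
  have h1 := DepthGE.coker_lcomp hω hR hω' (LinearMap.lcomp R ω g) (DepthGE.dual hω hR hω' hB)
    (DepthGE.dual hω hR hω' hA) hC
  have h2 : DepthGE R d ((ω →ₗ[R] ω) ⊗[R] (B ⧸ LinearMap.range g)) := by
    have hex := lTensor_exact (ω →ₗ[R] ω) (LinearMap.exact_map_mkQ_range g)
      (Submodule.mkQ_surjective _)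
    let e := LinearEquiv.ofBijective (biduality R ω B)
      ⟨biduality_injective hω hR hω' hB, biduality_surjective hω hR hω' hB⟩
    have hmap : (LinearMap.range (g.lTensor (ω →ₗ[R] ω))).map (e : _ →ₗ[R] _) =
        LinearMap.range (LinearMap.lcomp R ω (LinearMap.lcomp R ω g)) := by
      rw [← LinearMap.range_comp]
      have : (e : _ →ₗ[R] _) ∘ₗ g.lTensor (ω →ₗ[R] ω) =
          LinearMap.lcomp R ω (LinearMap.lcomp R ω g) ∘ₗ biduality R ω A :=
        LinearMap.ext (biduality_lTensor g)
      rw [this, LinearMap.range_comp_of_range_eq_top]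
      exact LinearMap.range_eq_top.2 (biduality_surjective hω hR hω' hA)
    exact h1.of_equiv ((hex.linearEquivOfSurjective
      (LinearMap.lTensor_surjective _ (Submodule.mkQ_surjective _))).symm ≪≫ₗ
      Submodule.Quotient.equiv _ _ e hmap)
  obtain ⟨f, g, h⟩ := exists_retract_end_tensor hω hR hR' hω' (B ⧸ LinearMap.range g)
  exact h2.of_retract f g h

end Retract

section Localize

variable {R : Type} [CommRing R]

theorem DepthGE.of_retract_localization {p : Ideal R} [p.IsPrime] {A B : Type} [AddCommGroup A]
    [Module R A] [AddCommGroup B] [Module R B] {n : ℕ} (f : A →ₗ[R] B) (g : B →ₗ[R] A)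
    (h : g ∘ₗ f = LinearMap.id)
    (hB : DepthGE (Localization.AtPrime p) n (LocalizedModule p.primeCompl B)) :
    DepthGE (Localization.AtPrime p) n (LocalizedModule p.primeCompl A) := by
  refine hB.of_retract (LocalizedModule.map p.primeCompl f) (LocalizedModule.map p.primeCompl g) ?_
  ext x
  induction x using LocalizedModule.induction_on with
  | h a s => simp [LocalizedModule.map_mk, ← LinearMap.comp_apply, h]

variable [IsLocalRing R] [IsNoetherianRing R]

omit [IsNoetherianRing R] in
theorem maximalIdeal_smul_top_lt {Y : Type} [AddCommGroup Y] [Module R Y] [Module.Finite R Y]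
    [Nontrivial Y] : maximalIdeal R • (⊤ : Submodule R Y) < ⊤ :=
  lt_top_iff_ne_top.2 (Submodule.top_ne_ideal_smul_of_le_jacobson_annihilator
    (maximalIdeal_le_jacobson _)).symm

omit [IsNoetherianRing R] in
theorem support_residue :
    Module.support R (R ⧸ maximalIdeal R) = PrimeSpectrum.zeroLocus (maximalIdeal R) := by
  rw [Module.support_eq_zeroLocus, Ideal.annihilator_quotient]

/-- Depth is detected by regular sequences. -/
theorem depthGE_iff_exists_isRegular {Y : Type} [AddCommGroup Y] [Module R Y] [Module.Finite R Y]
    [Nontrivial Y] {n : ℕ} : DepthGE R n Y ↔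
      ∃ rs : List R, rs.length = n ∧ (∀ r ∈ rs, r ∈ maximalIdeal R) ∧
        RingTheory.Sequence.IsRegular Y rs := by
  constructor
  · exact ModuleCat.exists_isRegular_of_exists_subsingleton_ext
      (maximalIdeal R) n (ModuleCat.of R Y) maximalIdeal_smul_top_lt
      (ModuleCat.of R (R ⧸ maximalIdeal R)) support_residue
  · rintro ⟨rs, rfl, hmem, hreg⟩
    exact ModuleCat.subsingleton_ext_of_exists_isRegular (maximalIdeal R)
      (ModuleCat.of R (R ⧸ maximalIdeal R)) support_residue.subset (ModuleCat.of R Y)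
      maximalIdeal_smul_top_lt rs hmem hreg

/-- The depth of a nonzero finitely generated module is at most the dimension of the ring. -/
theorem DepthGE.le_ringKrullDim {Y : Type} [AddCommGroup Y] [Module R Y] [Module.Finite R Y]
    [Nontrivial Y] {n : ℕ} (h : DepthGE R n Y) : (n : WithBot ℕ∞) ≤ ringKrullDim R := by
  obtain ⟨rs, rfl, hmem, hreg⟩ := depthGE_iff_exists_isRegular.1 h
  have h1 := Module.supportDim_add_length_eq_supportDim_of_isRegular rs hreg
  have : Nontrivial (Y ⧸ Ideal.ofList rs • (⊤ : Submodule R Y)) :=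
    Submodule.Quotient.nontrivial_iff.2 hreg.top_ne_smul.symm
  have h2 : 0 ≤ Module.supportDim R (Y ⧸ Ideal.ofList rs • (⊤ : Submodule R Y)) :=
    Order.krullDim_nonneg_iff.2 Module.nonempty_support_of_nontrivial.to_subtype
  calc (rs.length : WithBot ℕ∞) = 0 + rs.length := (zero_add _).symm
    _ ≤ _ := by gcongr
    _ = _ := h1
    _ ≤ _ := Module.supportDim_le_ringKrullDim R Y

/-- Depth is invariant under isomorphisms of local rings. -/
theorem DepthGE.of_bijective_algebraMap {S : Type} [CommRing S] [IsLocalRing S]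
    [IsNoetherianRing S] [Algebra R S] (hS : Function.Bijective (algebraMap R S)) {X Y : Type}
    [AddCommGroup X] [Module R X] [Module.Finite R X] [AddCommGroup Y] [Module R Y] [Module S Y]
    [IsScalarTower R S Y] [Module.Finite S Y] (e : X ≃ₗ[R] Y) {n : ℕ} (h : DepthGE S n Y) :
    DepthGE R n X := by
  cases subsingleton_or_nontrivial X with
  | inl hX => exact .of_subsingleton n
  | inr hX =>
    have := e.symm.nontrivial
    rw [depthGE_iff_exists_isRegular] at h ⊢
    obtain ⟨rs, hlen, hmem, hreg⟩ := h
    let σ := RingEquiv.ofBijective (algebraMap R S) hS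
    refine ⟨rs.map σ.symm, by simpa using hlen, ?_, ?_⟩
    · simp only [List.mem_map, forall_exists_index, and_imp, forall_apply_eq_imp_iff₂]
      intro r hr
      have := hmem r hr
      simpa [mem_nonunits_iff] using this
    · refine (e.toAddEquiv.isRegular_congr (bs := rs) ?_).2 hreg
      rw [List.forall₂_map_left_iff, List.forall₂_same]
      intro r _ x
      have : algebraMap R S (σ.symm r) = r := σ.apply_symm_apply r
      conv_rhs => rw [← this]
      simp

end Localize

section MCM

variable {R : Type} [CommRing R] [IsNoetherianRing R] [IsLocalRing R] {d : ℕ}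

omit [IsNoetherianRing R] [IsLocalRing R] in
theorem IsMCM.depthGE_localization {X : Type} [AddCommGroup X] [Module R X] (hX : IsMCM R X)
    (p : Ideal R) [hp : p.IsPrime] {e : ℕ} (he : ringKrullDim (Localization.AtPrime p) = e) :
    DepthGE (Localization.AtPrime p) e (LocalizedModule p.primeCompl X) := by
  cases subsingleton_or_nontrivial (LocalizedModule p.primeCompl X) with
  | inl h => exact .of_subsingleton e
  | inr h =>
    have := hX ⟨p, hp⟩ h
    rw [he] at this
    exact (moduleDepth_eq_iff.1 (WithBot.coe_injective this)).1

theorem IsMCM.depthGE (hd : ringKrullDim R = d) {X : Type} [AddCommGroup X] [Module R X]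
    [Module.Finite R X] (hX : IsMCM R X) : DepthGE R d X := by
  have hunit : (maximalIdeal R).primeCompl ≤ IsUnit.submonoid R := fun x hx => by
    simpa [Ideal.primeCompl, IsUnit.mem_submonoid_iff] using hx
  let σ := IsLocalization.atUnits R (maximalIdeal R).primeCompl
    (S := Localization.AtPrime (maximalIdeal R)) hunit
  have hdim : ringKrullDim (Localization.AtPrime (maximalIdeal R)) = d := by
    rw [← hd]; exact (ringKrullDim_eq_of_ringEquiv σ.toRingEquiv).symm
  have hσ : Function.Bijective (algebraMap R (Localization.AtPrime (maximalIdeal R))) := by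
    convert σ.bijective using 1
    ext x
    exact (σ.commutes x).symm
  have hid : IsLocalizedModule (maximalIdeal R).primeCompl (LinearMap.id : X →ₗ[R] X) := by
    have : IsLocalization (maximalIdeal R).primeCompl R := IsLocalization.of_le_isUnit hunit
    exact isLocalizedModule_id _ _ R
  exact .of_bijective_algebraMap hσ (IsLocalizedModule.linearEquiv (maximalIdeal R).primeCompl
    LinearMap.id (LocalizedModule.mkLinearMap (maximalIdeal R).primeCompl X))
    (hX.depthGE_localization _ hdim)

variable {ω : Type} [AddCommGroup ω] [Module R ω] [Module.Finite R ω] [Nontrivial ω]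
  (hω : ExtVanishesAbove R d ω) (hR : DepthGE R d R)
  (hR' : ¬ ExtZero R (R ⧸ maximalIdeal R) R d) (hω' : DepthGE R d ω) (hm : IsMCM R ω)
include hω hR hR' hω' hm

theorem DepthGE.isMCM {X : Type} [AddCommGroup X] [Module R X]
    [Module.Finite R X] (hX : DepthGE R d X) : IsMCM R X := by
  rintro ⟨p, hp⟩ hnt
  obtain ⟨e, he⟩ : ∃ e : ℕ, ringKrullDim (Localization.AtPrime p) = e := by
    obtain ⟨e, he⟩ := WithBot.ne_bot_iff_exists.1
      (ringKrullDim_ne_bot (R := Localization.AtPrime p))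
    have htop : e ≠ ⊤ := by
      rintro rfl
      exact ringKrullDim_ne_top (R := Localization.AtPrime p) he.symm
    obtain ⟨k, rfl⟩ := ENat.ne_top_iff_exists.1 htop
    exact ⟨k, he.symm⟩
  have h1 := (isDepthLike_depthGE_localization p).dual hω hR
    (fun _ hm' => (hm.depthGE_localization p he).mono hm') (DepthGE.dual hω hR hω' hX)
  obtain ⟨f, g, h⟩ := exists_retract_bidual hω hR hR' hω' X hX
  have h2 := h1.of_retract_localization f g h
  simp only at hnt ⊢
  rw [he]
  refine congrArg _ (le_antisymm (not_lt.1 fun hlt => ?_) (le_moduleDepth_iff.2 h2))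
  have h3 := (le_moduleDepth_iff.1
    (Order.add_one_le_of_lt hlt : ((e + 1 : ℕ) : ℕ∞) ≤ _)).le_ringKrullDim
  rw [he] at h3
  exact absurd (by exact_mod_cast h3) (Nat.not_succ_le_self e)

theorem isMCM_iff_depthGE (hd : ringKrullDim R = d) {X : Type} [AddCommGroup X] [Module R X]
    [Module.Finite R X] : IsMCM R X ↔ DepthGE R d X :=
  ⟨fun h => h.depthGE hd, DepthGE.isMCM hω hR hR' hω' hm⟩

end MCM

section HomTensor

variable (R : Type) [CommRing R] (N ω : Type) [AddCommGroup N] [Module R N]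
  [AddCommGroup ω] [Module R ω]

/-- `V* ⊗ Hom(N, ω) ≃ Hom(V ⊗ N, ω)` for `V` finite free. -/
noncomputable def dualTensorHomEquivHomTensor (V : Type) [AddCommGroup V] [Module R V]
    [Module.Free R V] [Module.Finite R V] :
    Module.Dual R V ⊗[R] (N →ₗ[R] ω) ≃ₗ[R] (V ⊗[R] N →ₗ[R] ω) :=
  rTensorHomEquivHomRTensor R V R (N →ₗ[R] ω) ≪≫ₗ
    LinearEquiv.congrRight (TensorProduct.lid R (N →ₗ[R] ω)) ≪≫ₗ
    TensorProduct.lift.equiv (.id R) V N ω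

variable {V W : Type} [AddCommGroup V] [Module R V] [Module.Free R V] [Module.Finite R V]
  [AddCommGroup W] [Module R W] [Module.Free R W] [Module.Finite R W] (f : V →ₗ[R] W)

theorem dualTensorHomEquivHomTensor_naturality :
    (dualTensorHomEquivHomTensor R N ω V : _ →ₗ[R] _) ∘ₗ f.dualMap.rTensor (N →ₗ[R] ω) =
      LinearMap.lcomp R ω (f.rTensor N) ∘ₗ
        (dualTensorHomEquivHomTensor R N ω W : _ →ₗ[R] _) := by
  ext
  simp [dualTensorHomEquivHomTensor, LinearEquiv.congrRight, LinearEquiv.arrowCongr_apply]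

theorem map_range_dualMap_rTensor :
    (LinearMap.range (f.dualMap.rTensor (N →ₗ[R] ω))).map
      (dualTensorHomEquivHomTensor R N ω V : _ →ₗ[R] _) =
        LinearMap.range (LinearMap.lcomp R ω (f.rTensor N)) := by
  rw [← LinearMap.range_comp, dualTensorHomEquivHomTensor_naturality,
    LinearMap.range_comp_of_range_eq_top _ (LinearEquiv.range _)]

omit [Module.Free R V] [Module.Finite R V] [Module.Free R W] [Module.Finite R W] in
/-- The cokernel of `f ⊗ N` is the tensor product of the cokernel of `f` with `N`. -/
noncomputable def cokerTensorEquiv : ((W ⧸ LinearMap.range f) ⊗[R] N) ≃ₗ[R]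
    ((W ⊗[R] N) ⧸ LinearMap.range (f.rTensor N)) :=
  ((rTensor_exact N (LinearMap.exact_map_mkQ_range f)
      (Submodule.mkQ_surjective _)).linearEquivOfSurjective
      (LinearMap.rTensor_surjective _ (Submodule.mkQ_surjective _))).symm

/-- The cokernel of `f* ⊗ Hom(N, ω)` is the cokernel of `Hom(f ⊗ N, ω)`. -/
noncomputable def cokerDualMapTensorEquiv :
    ((Module.Dual R V ⧸ LinearMap.range f.dualMap) ⊗[R] (N →ₗ[R] ω)) ≃ₗ[R]
      ((V ⊗[R] N →ₗ[R] ω) ⧸ LinearMap.range (LinearMap.lcomp R ω (f.rTensor N))) :=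
  cokerTensorEquiv R (N →ₗ[R] ω) f.dualMap ≪≫ₗ
    Submodule.Quotient.equiv _ _ (dualTensorHomEquivHomTensor R N ω V)
      (map_range_dualMap_rTensor R N ω f)

end HomTensor

theorem DepthGE.pi_tensor {R : Type} [CommRing R] [IsLocalRing R] {d : ℕ} {N : Type}
    [AddCommGroup N] [Module R N] (hN : DepthGE R d N) (a : ℕ) :
    DepthGE R d ((Fin a → R) ⊗[R] N) :=
  (hN.pi a).of_equiv (TensorProduct.comm R _ _ ≪≫ₗ TensorProduct.piScalarRight R R N (Fin a))

/-- Over a Cohen–Macaulay local ring with canonical module `ω`, for `N` maximal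
Cohen–Macaulay, `M ⊗ N` is MCM iff `Tr M ⊗ Hom(N, ω)` is MCM. -/
theorem tensor_mcm_iff_transpose_tensor_dual_mcm (R : Type) [CommRing R] [IsNoetherianRing R]
    [IsLocalRing R] (hCM : IsCMLocal R)
    (ω : Type) [AddCommGroup ω] [Module R ω] (hω : IsCanonicalModule R ω)
    (M N T : Type) [AddCommGroup M] [Module R M] [Module.Finite R M]
    [AddCommGroup N] [Module R N] [Module.Finite R N]
    [AddCommGroup T] [Module R T]
    (hN : IsMCM R N) (hT : IsAuslanderTranspose R M T) :
    IsMCM R (TensorProduct R M N) ↔ IsMCM R (TensorProduct R T (N →ₗ[R] ω)) := by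
  obtain ⟨hfin, hm, ⟨n, hinj⟩, d, hd, ⟨e⟩⟩ := hω
  obtain ⟨hR, hR'⟩ : DepthGE R d R ∧ ¬ ExtZero R (R ⧸ maximalIdeal R) R d := by
    rw [IsCMLocal, hd] at hCM
    exact moduleDepth_eq_iff.1 (WithBot.coe_injective hCM)
  have hnt : Nontrivial ω := by
    by_contra h
    rw [not_nontrivial_iff_subsingleton] at h
    have := (subsingleton_extGroup_iff (R := R) d).2
      (ExtZero.of_subsingleton_right (X := R ⧸ maximalIdeal R) (A := ω) d)
    exact not_subsingleton _ e.symm.toEquiv.subsingleton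
  have hω := extVanishesAbove_of_hasInjDimLE hR hR' hinj
  have hω' : DepthGE R d ω := hm.depthGE hd
  have hN' : DepthGE R d N := hN.depthGE hd
  obtain ⟨a, b, f, -, -, ⟨eM⟩, ⟨eT⟩⟩ := hT
  have hTfin : Module.Finite R T := Module.Finite.equiv eT
  rw [isMCM_iff_depthGE hω hR hR' hω' hm hd, isMCM_iff_depthGE hω hR hR' hω' hm hd]
  let e₁ := (eM.symm.rTensor N) ≪≫ₗ cokerTensorEquiv R N f
  let e₂ := (eT.symm.rTensor (N →ₗ[R] ω)) ≪≫ₗ cokerDualMapTensorEquiv R N ω f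
  constructor
  · intro h
    exact (DepthGE.coker_lcomp hω hR hω' (f.rTensor N) (hN'.pi_tensor b) (hN'.pi_tensor a)
      (h.of_equiv e₁.symm)).of_equiv e₂
  · intro h
    exact (DepthGE.of_coker_lcomp hω hR hR' hω' (f.rTensor N) (hN'.pi_tensor b) (hN'.pi_tensor a)
      (h.of_equiv e₂.symm)).of_equiv e₁
end
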